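/- arXiv:1504.07257 — 2 statements merged into one kernel-verified Lean document; each statement's English description precedes it below -/
import Mathlib

section
/- Let R be a ring, 'C = 'C_R, a = ass_R('C) and 'M := {S ∈ maxDen_l(R) | 'C ⊆ S}. The following are equivalent: (1) 'C is a left denominator set of R and 'Q_{l,cl}(R) := 'C⁻¹R is a semisimple Artinian ring; (2) 'M is a finite nonempty set, ⋂_{S ∈ 'M} ass_R(S) = a, for each S ∈ 'M the ring S⁻¹R is a simple Artinian ring, and the set 'C̄ := {c + a | c ∈ 'C} is a dense subset of C_{R/a} in R̄ := R/a. Moreover, if these conditions hold, then the map 'M → maxDen_l(R̄), S ↦ π(S) (where π : R → R̄), is a bijection with inverse T ↦ π⁻¹(T); for all S ∈ 'M, a ⊆ ass_R(S) and π(ass_R(S)) = ass_{R̄}(π(S)); for all S ∈ 'M, S⁻¹R ≅ π(S)⁻¹R̄ is a simple Artinian ring; and 'Q_{l,cl}(R) ≅ ∏_{S ∈ 'M} S⁻¹R ≅ ∏_{T ∈ maxDen_l(R̄)} T⁻¹R̄ ≅ Q_{l,cl}(R̄). -/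
universe u

namespace Bavula

/-- The set of left regular elements of `R`. -/
def lReg (R : Type u) [Ring R] : Set R := {c : R | ∀ x : R, x * c = 0 → x = 0}

/-- The set of right regular elements of `R`. -/
def rReg (R : Type u) [Ring R] : Set R := {c : R | ∀ x : R, c * x = 0 → x = 0}

/-- The set of regular elements of `R`. -/
def reg (R : Type u) [Ring R] : Set R := lReg R ∩ rReg R

/-- `S` is a multiplicative set of `R`. -/
def IsMulSet {R : Type u} [Ring R] (S : Set R) : Prop :=
  (1 : R) ∈ S ∧ (∀ a ∈ S, ∀ b ∈ S, a * b ∈ S) ∧ (0 : R) ∉ S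

/-- `S` is a left Ore set of `R`. -/
def IsLeftOre {R : Type u} [Ring R] (S : Set R) : Prop :=
  IsMulSet S ∧ ∀ s ∈ S, ∀ r : R, ∃ s' ∈ S, ∃ r' : R, s' * r = r' * s

/-- `S` is a left denominator set of `R`. -/
def IsLeftDenom {R : Type u} [Ring R] (S : Set R) : Prop :=
  IsLeftOre S ∧ ∀ r : R, ∀ s ∈ S, r * s = 0 → ∃ t ∈ S, t * r = 0

/-- `S` is a right Ore set of `R`. -/
def IsRightOre {R : Type u} [Ring R] (S : Set R) : Prop :=
  IsMulSet S ∧ ∀ s ∈ S, ∀ r : R, ∃ s' ∈ S, ∃ r' : R, r * s' = s * r'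

/-- `S` is a right denominator set of `R`. -/
def IsRightDenom {R : Type u} [Ring R] (S : Set R) : Prop :=
  IsRightOre S ∧ ∀ r : R, ∀ s ∈ S, s * r = 0 → ∃ t ∈ S, r * t = 0

/-- `ass_R(S) = {r ∈ R | s r = 0 for some s ∈ S}`. -/
def ass {R : Type u} [Ring R] (S : Set R) : Set R := {r : R | ∃ s ∈ S, s * r = 0}

/-- `{r ∈ R | r s = 0 for some s ∈ S}` (the right-sided analogue of `ass`). -/
def rass {R : Type u} [Ring R] (S : Set R) : Set R := {r : R | ∃ s ∈ S, r * s = 0}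

/-- `S` is a (left) dense subset of `T`. -/
def DenseIn {R : Type u} [Ring R] (S T : Set R) : Prop := ∀ t ∈ T, ∃ r : R, r * t ∈ S

/-- `f : R →+* Q` realizes `Q` as the left localization `S⁻¹R` of `R` at `S`:
elements of `S` become units, every element of `Q` is a left fraction `(f s)⁻¹ * (f r)`,
and the kernel of `f` is `ass S`. -/
def IsLeftLoc {R : Type u} [Ring R] (S : Set R) {Q : Type u} [Ring Q] (f : R →+* Q) : Prop :=
  (∀ s ∈ S, IsUnit (f s)) ∧
  (∀ q : Q, ∃ s ∈ S, ∃ r : R, f s * q = f r) ∧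
  (∀ r : R, f r = 0 ↔ r ∈ ass S)

/-- `π : R →+* Q` realizes `Q` as the quotient of `R` by the set `a`
(in particular, `a` is then a two-sided ideal of `R`). -/
def IsQuotBy {R : Type u} [Ring R] (a : Set R) {Q : Type u} [Ring Q] (π : R →+* Q) : Prop :=
  Function.Surjective π ∧ ∀ r : R, π r = 0 ↔ r ∈ a

/-- A semiprime ring (no nonzero nilpotent ideals), elementwise: `x R x = 0 → x = 0`. -/
def SemiprimeRing (A : Type u) [Ring A] : Prop := ∀ x : A, (∀ r : A, x * r * x = 0) → x = 0

/-- `a` is a two-sided ideal of `R`, given as a set. -/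
def IsIdealSet {R : Type u} [Ring R] (a : Set R) : Prop :=
  (0 : R) ∈ a ∧ (∀ x ∈ a, ∀ y ∈ a, x + y ∈ a) ∧ ∀ r : R, ∀ x ∈ a, r * x ∈ a ∧ x * r ∈ a

/-- `a` is a semiprime (two-sided) ideal of `R`, i.e. `R/a` is a semiprime ring. -/
def IsSemiprimeIdealSet {R : Type u} [Ring R] (a : Set R) : Prop :=
  IsIdealSet a ∧ ∀ x : R, (∀ r : R, x * r * x ∈ a) → x ∈ a

/-- `a` is a prime (two-sided) ideal of `R`, i.e. `R/a` is a prime ring. -/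
def IsPrimeIdealSet {R : Type u} [Ring R] (a : Set R) : Prop :=
  IsIdealSet a ∧ a ≠ Set.univ ∧ ∀ x y : R, (∀ r : R, x * r * y ∈ a) → x ∈ a ∨ y ∈ a

/-- The prime radical of `A`: the intersection of all prime ideals of `A`. -/
def primeRadical (A : Type u) [Ring A] : Set A :=
  {x : A | ∀ p : Set A, IsPrimeIdealSet p → x ∈ p}

/-- The set of prime ideals of `R` minimal over `a`. -/
def minPrimesOver {R : Type u} [Ring R] (a : Set R) : Set (Set R) :=
  {p : Set R | IsPrimeIdealSet p ∧ a ⊆ p ∧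
    ∀ q : Set R, IsPrimeIdealSet q → a ⊆ q → q ⊆ p → q = p}

/-- A simple ring: nontrivial, with no two-sided ideals other than `0` and `A`. -/
def SimpleRing (A : Type u) [Ring A] : Prop :=
  (0 : A) ≠ 1 ∧ ∀ a : Set A, IsIdealSet a → a = {0} ∨ a = Set.univ

/-- A simple (left) Artinian ring. -/
def SimpleArtinianRing (A : Type u) [Ring A] : Prop := SimpleRing A ∧ IsArtinianRing A

/-- `I` is an essential left ideal of `R`. -/
def EssIdeal {R : Type u} [Ring R] (I : Submodule R R) : Prop :=
  ∀ J : Submodule R R, J ≠ ⊥ → I ⊓ J ≠ ⊥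

/-- `N` is an essential submodule of the left ideal `M`. -/
def EssIn {R : Type u} [Ring R] (N M : Submodule R R) : Prop :=
  N ≤ M ∧ ∀ W : Submodule R R, W ≤ M → W ≠ ⊥ → N ⊓ W ≠ ⊥

/-- `U` is a uniform left ideal of `R`. -/
def UniformIdeal {R : Type u} [Ring R] (U : Submodule R R) : Prop :=
  U ≠ ⊥ ∧ ∀ V W : Submodule R R, V ≤ U → W ≤ U → V ≠ ⊥ → W ≠ ⊥ → V ⊓ W ≠ ⊥

/-- `udim(_A A) < ∞`: there is a finite direct sum of uniform left ideals of `A`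
which is an essential left ideal of `A`. -/
def FinUdim (A : Type u) [Ring A] : Prop :=
  ∃ (n : ℕ) (U : Fin (n + 1) → Submodule A A),
    (∀ i, UniformIdeal (U i)) ∧
    (∀ i, U i ⊓ (⨆ j, ⨆ (_ : j ≠ i), U j) = ⊥) ∧
    EssIdeal (⨆ i, U i)

/-- `'C_V = {v ∈ V | right multiplication by v is injective on V}` for a left ideal `V`. -/
def lRegIn {R : Type u} [Ring R] (V : Submodule R R) : Set R :=
  {v : R | v ∈ V ∧ ∀ x ∈ V, x * v = 0 → x = 0}

/-- The family `P` of subsets of `R` satisfies the ascending chain condition. -/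
def AccOnSets {R : Type u} [Ring R] (P : Set (Set R)) : Prop :=
  ∀ f : ℕ → Set R, (∀ n, f n ∈ P) → (∀ n, f n ⊆ f (n + 1)) →
    ∃ N : ℕ, ∀ n : ℕ, N ≤ n → f n = f N

/-- The left annihilator of `X` in `R`. -/
def lAnn {R : Type u} [Ring R] (X : Set R) : Set R := {r : R | ∀ x ∈ X, r * x = 0}

/-- The right annihilator of `X` in `R`. -/
def rAnn {R : Type u} [Ring R] (X : Set R) : Set R := {r : R | ∀ x ∈ X, x * r = 0}

/-- A left Goldie ring: a.c.c. on left annihilators and finite left uniform dimension. -/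
def LeftGoldie (A : Type u) [Ring A] : Prop :=
  AccOnSets {B : Set A | ∃ X : Set A, B = lAnn X} ∧ FinUdim A

/-- The set of maximal left denominator sets of `A`. -/
def maxLeftDenom (A : Type u) [Ring A] : Set (Set A) :=
  {S : Set A | IsLeftDenom S ∧ ∀ T : Set A, IsLeftDenom T → S ⊆ T → S = T}

/-- `S_p = {c ∈ R | c + p ∈ C_{R/p}}`: the elements regular modulo `p`. -/
def regMod {R : Type u} [Ring R] (p : Set R) : Set R :=
  {c : R | (∀ x : R, x * c ∈ p → x ∈ p) ∧ ∀ x : R, c * x ∈ p → x ∈ p}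

/-- `I` is a right ideal of `R`, given as a set. -/
def IsRightIdealSet {R : Type u} [Ring R] (I : Set R) : Prop :=
  (0 : R) ∈ I ∧ (∀ x ∈ I, ∀ y ∈ I, x + y ∈ I) ∧ ∀ x ∈ I, ∀ r : R, x * r ∈ I

/-- The left singular ideal `ζ_l(R, a)` of `R` over `a`. -/
def leftSingularOver {R : Type u} [Ring R] (a : Set R) : Set R :=
  {r : R | ∃ I : Submodule R R, EssIdeal I ∧ a ⊆ I ∧ ∀ x ∈ I, x * r = 0}

section Aux

theorem isUnit_of_lReg {Q : Type u} [Ring Q] [IsArtinianRing Q] {t : Q}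
    (h : ∀ x : Q, x * t = 0 → x = 0) : IsUnit t := by
  have hinj : Function.Injective (LinearMap.toSpanSingleton Q Q t) := by
    rw [← LinearMap.ker_eq_bot, LinearMap.ker_eq_bot']
    intro m hm
    exact h m (by simpa using hm)
  obtain ⟨y, hy⟩ := IsArtinian.surjective_of_injective_endomorphism _ hinj 1
  have hy' : y * t = 1 := by simpa using hy
  have h2 : t * y = 1 := by
    have : (t * y - 1) * t = 0 := by rw [sub_mul, mul_assoc, hy']; simp
    exact sub_eq_zero.mp (h _ this)
  exact ⟨⟨t, y, h2, hy'⟩, rfl⟩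

theorem SimpleRing.of_isSimpleRing {Q : Type u} [Ring Q] [IsSimpleRing Q] : SimpleRing Q := by
  refine ⟨zero_ne_one, fun a ha => ?_⟩
  by_cases h : ∃ x ∈ a, x ≠ 0
  · right
    obtain ⟨x, hx, hx0⟩ := h
    let I : TwoSidedIdeal Q := TwoSidedIdeal.mk' a ha.1 (fun hx hy => ha.2.1 _ hx _ hy)
      (fun {x} hx => by simpa using (ha.2.2 (-1) x hx).1)
      (fun {x y} hy => (ha.2.2 x y hy).1) (fun {x y} hx => (ha.2.2 y x hx).2)
    have h1 : (1 : Q) ∈ I := IsSimpleRing.one_mem_of_ne_zero_mem I hx0 (by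
      simpa [I, TwoSidedIdeal.mem_mk'] using hx)
    have h1' : (1 : Q) ∈ a := by simpa [I, TwoSidedIdeal.mem_mk'] using h1
    ext q
    simpa using (ha.2.2 q 1 h1').1
  · left
    push Not at h
    ext x
    constructor
    · intro hx; exact h x hx
    · intro hx
      rw [Set.mem_singleton_iff.mp hx]; exact ha.1

theorem SimpleRing.isSimpleRing {Q : Type u} [Ring Q] (h : SimpleRing Q) : IsSimpleRing Q := by
  have : Nontrivial Q := ⟨⟨0, 1, h.1⟩⟩
  refine IsSimpleRing.of_eq_bot_or_eq_top fun I => ?_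
  rcases h.2 (I : Set Q) ⟨I.zero_mem, fun x hx y hy => I.add_mem hx hy,
    fun r x hx => ⟨I.mul_mem_left _ _ hx, I.mul_mem_right _ _ hx⟩⟩ with h | h
  · left
    ext x
    have : x ∈ (I : Set Q) ↔ x ∈ ({0} : Set Q) := by rw [h]
    simpa [TwoSidedIdeal.mem_bot] using this
  · right
    ext x
    have : x ∈ (I : Set Q) ↔ x ∈ (Set.univ : Set Q) := by rw [h]
    simpa using this

theorem SimpleArtinianRing.isSemisimpleRing {Q : Type u} [Ring Q] (h : SimpleArtinianRing Q) :
    IsSemisimpleRing Q := by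
  have := h.1.isSimpleRing
  have := h.2
  infer_instance

theorem SimpleArtinianRing.of_ringEquiv {Q Q' : Type u} [Ring Q] [Ring Q'] (e : Q ≃+* Q')
    (h : SimpleArtinianRing Q) : SimpleArtinianRing Q' := by
  have := h.1.isSimpleRing
  have := h.2
  have : IsSimpleRing Q' := IsSimpleRing.of_ringEquiv e ‹_›
  exact ⟨SimpleRing.of_isSimpleRing, e.isArtinianRing⟩

variable {A : Type u} [Ring A]

/-- A multiplicative set at which there is a left localization is a left denominator set. -/
theorem IsLeftLoc.isLeftDenom {S : Set A} {Q : Type u} [Ring Q] {f : A →+* Q}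
    (h : IsLeftLoc S f) (hS : IsMulSet S) : IsLeftDenom S := by
  obtain ⟨h1, h2, h3⟩ := h
  refine ⟨⟨hS, fun s hs r => ?_⟩, fun r s hs hrs => ?_⟩
  · obtain ⟨u, hu⟩ := h1 s hs
    obtain ⟨c, hc, r', hr'⟩ := h2 (f r * ↑u⁻¹)
    have : f (c * r - r' * s) = 0 := by
      rw [map_sub, map_mul, map_mul, ← hr', ← hu]
      simp [mul_assoc]
    obtain ⟨t, ht, htt⟩ := (h3 _).mp this
    refine ⟨t * c, hS.2.1 _ ht _ hc, t * r', ?_⟩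
    rw [mul_sub, sub_eq_zero] at htt
    simpa [mul_assoc] using htt
  · have : f r * f s = 0 := by rw [← map_mul, hrs, map_zero]
    exact (h3 r).mp ((h1 s hs).mul_left_eq_zero.mp this)

theorem ass_isIdealSet {S : Set A} (h : IsLeftDenom S) : IsIdealSet (ass S) := by
  obtain ⟨⟨hS, hore⟩, hd⟩ := h
  refine ⟨⟨1, hS.1, by simp⟩, ?_, ?_⟩
  · rintro x ⟨s, hs, hx⟩ y ⟨s', hs', hy⟩
    obtain ⟨t, ht, u, htu⟩ := hore s' hs' s
    refine ⟨t * s, hS.2.1 _ ht _ hs, ?_⟩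
    rw [mul_add, mul_assoc, hx, htu, mul_assoc, hy]; simp
  · rintro r x ⟨s, hs, hx⟩
    constructor
    · obtain ⟨t, ht, u, htu⟩ := hore s hs r
      exact ⟨t, ht, by rw [← mul_assoc, htu, mul_assoc, hx, mul_zero]⟩
    · exact ⟨s, hs, by rw [← mul_assoc, hx, zero_mul]⟩

/-- Universal property of left localization. -/
theorem IsLeftLoc.exists_lift {S : Set A} (hS : IsLeftDenom S) {Q : Type u} [Ring Q] {f : A →+* Q}
    (h : IsLeftLoc S f) {B : Type u} [Ring B] (g : A →+* B) (hg : ∀ s ∈ S, IsUnit (g s)) :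
    ∃ φ : Q →+* B, ∀ a, φ (f a) = g a := by
  obtain ⟨h1, h2, h3⟩ := h
  obtain ⟨⟨hm, hore⟩, hd⟩ := hS
  let H : Q → B → Prop := fun q b => ∃ s ∈ S, ∃ r : A, f s * q = f r ∧ g s * b = g r
  have hadd : ∀ q b q' b', H q b → H q' b' → H (q + q') (b + b') := by
    rintro q b q' b' ⟨s, hs, r, e1, e2⟩ ⟨s', hs', r', e1', e2'⟩
    obtain ⟨t, ht, u, htu⟩ := hore s' hs' s
    refine ⟨t * s, hm.2.1 _ ht _ hs, t * r + u * r', ?_, ?_⟩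
    · rw [mul_add, map_add]
      nth_rewrite 2 [htu]
      simp only [map_mul, mul_assoc, e1, e1']
    · rw [mul_add, map_add]
      nth_rewrite 2 [htu]
      simp only [map_mul, mul_assoc, e2, e2']
  have hmul : ∀ q b q' b', H q b → H q' b' → H (q * q') (b * b') := by
    rintro q b q' b' ⟨s, hs, r, e1, e2⟩ ⟨s', hs', r', e1', e2'⟩
    obtain ⟨t, ht, u, htu⟩ := hore s' hs' r
    refine ⟨t * s, hm.2.1 _ ht _ hs, u * r', ?_, ?_⟩
    · calc f (t * s) * (q * q') = f t * (f s * q) * q' := by simp only [map_mul, mul_assoc]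
        _ = f (t * r) * q' := by rw [e1, map_mul]
        _ = f (u * r') := by rw [htu, map_mul, map_mul, mul_assoc, e1']
    · calc g (t * s) * (b * b') = g t * (g s * b) * b' := by simp only [map_mul, mul_assoc]
        _ = g (t * r) * b' := by rw [e2, map_mul]
        _ = g (u * r') := by rw [htu, map_mul, map_mul, mul_assoc, e2']
  have hneg : ∀ q b, H q b → H (-q) (-b) := by
    rintro q b ⟨s, hs, r, e1, e2⟩
    exact ⟨s, hs, -r, by simp [e1], by simp [e2]⟩
  have hf : ∀ a, H (f a) (g a) := fun a => ⟨1, hm.1, a, by simp, by simp⟩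
  have hz : ∀ b, H 0 b → b = 0 := by
    rintro b ⟨s, hs, r, e1, e2⟩
    rw [mul_zero] at e1
    obtain ⟨t, ht, htr⟩ := (h3 r).mp e1.symm
    have : g t * g r = 0 := by rw [← map_mul, htr, map_zero]
    rw [(hg t ht).mul_right_eq_zero] at this
    rw [this] at e2
    exact (hg s hs).mul_right_eq_zero.mp e2
  have huniq : ∀ q b b', H q b → H q b' → b = b' := by
    intro q b b' hb hb'
    have := hadd _ _ _ _ hb (hneg _ _ hb')
    rw [add_neg_cancel] at this
    exact sub_eq_zero.mp (by simpa [sub_eq_add_neg] using hz _ this)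
  have hex : ∀ q, ∃ b, H q b := by
    intro q
    obtain ⟨s, hs, r, e⟩ := h2 q
    obtain ⟨u, hu⟩ := hg s hs
    exact ⟨↑u⁻¹ * g r, s, hs, r, e, by rw [← hu]; simp⟩
  choose φ hφ using hex
  refine ⟨{ toFun := φ, map_one' := ?_, map_mul' := ?_, map_zero' := ?_, map_add' := ?_ }, ?_⟩
  · exact huniq 1 _ _ (hφ 1) (by simpa using hf 1)
  · intro x y; exact huniq _ _ _ (hφ _) (hmul _ _ _ _ (hφ x) (hφ y))
  · exact hz _ (hφ 0)
  · intro x y; exact huniq _ _ _ (hφ _) (hadd _ _ _ _ (hφ x) (hφ y))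
  · intro a; exact huniq _ _ _ (hφ _) (hf a)

theorem IsLeftLoc.hom_eq_id {S : Set A} {Q : Type u} [Ring Q] {f : A →+* Q}
    (h : IsLeftLoc S f) (φ : Q →+* Q) (hφ : ∀ a, φ (f a) = f a) (q : Q) : φ q = q := by
  obtain ⟨s, hs, r, e⟩ := h.2.1 q
  have h1 : f s * φ q = f s * q := by
    rw [← hφ s, ← map_mul, e, hφ, hφ, e]
  exact (h.1 s hs).mul_left_cancel h1

/-- Uniqueness of left localizations. -/
theorem IsLeftLoc.ringEquiv {S : Set A} (hS : IsLeftDenom S) {Q Q' : Type u} [Ring Q] [Ring Q']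
    {f : A →+* Q} {f' : A →+* Q'} (h : IsLeftLoc S f) (h' : IsLeftLoc S f') :
    Nonempty (Q ≃+* Q') := by
  obtain ⟨φ, hφ⟩ := h.exists_lift hS f' h'.1
  obtain ⟨ψ, hψ⟩ := h'.exists_lift hS f h.1
  refine ⟨RingEquiv.ofRingHom φ ψ ?_ ?_⟩
  · ext q; exact h'.hom_eq_id (φ.comp ψ) (fun a => by simp [hφ, hψ]) q
  · ext q; exact h.hom_eq_id (ψ.comp φ) (fun a => by simp [hφ, hψ]) q

theorem IsLeftLoc.comp_equiv {S : Set A} {Q Q' : Type u} [Ring Q] [Ring Q'] {f : A →+* Q}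
    (h : IsLeftLoc S f) (e : Q ≃+* Q') : IsLeftLoc S ((e : Q →+* Q').comp f) := by
  refine ⟨fun s hs => (h.1 s hs).map (e : Q →+* Q'), fun q => ?_, fun r => ?_⟩
  · obtain ⟨s, hs, r, hr⟩ := h.2.1 (e.symm q)
    refine ⟨s, hs, r, ?_⟩
    have := congrArg e hr
    simpa using this
  · rw [← h.2.2 r]; simp

/-- In a localization which is simple Artinian, an ideal with nonzero image contains an element
which becomes a unit. -/
theorem IsLeftLoc.exists_isUnit {S : Set A} (hS : IsLeftDenom S) {Q : Type u} [Ring Q]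
    {f : A →+* Q} (h : IsLeftLoc S f) (hQ : SimpleArtinianRing Q) {b : Set A} (hb : IsIdealSet b)
    {y : A} (hy : y ∈ b) (hy0 : f y ≠ 0) : ∃ z ∈ b, IsUnit (f z) := by
  have := hQ.2
  obtain ⟨h1, h2, h3⟩ := h
  obtain ⟨⟨hm, hore⟩, hd⟩ := hS
  let L : Submodule Q Q :=
    { carrier := {q | ∃ s ∈ S, ∃ y ∈ b, f s * q = f y}
      zero_mem' := ⟨1, hm.1, 0, hb.1, by simp⟩
      add_mem' := by
        rintro q q' ⟨s, hs, r, hr, e1⟩ ⟨s', hs', r', hr', e1'⟩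
        obtain ⟨t, ht, u, htu⟩ := hore s' hs' s
        refine ⟨t * s, hm.2.1 _ ht _ hs, t * r + u * r',
          hb.2.1 _ (hb.2.2 _ _ hr).1 _ (hb.2.2 _ _ hr').1, ?_⟩
        rw [mul_add, map_add]
        nth_rewrite 2 [htu]
        simp only [map_mul, mul_assoc, e1, e1']
      smul_mem' := by
        rintro q q' ⟨s', hs', r', hr', e1'⟩
        obtain ⟨s, hs, r, e1⟩ := h2 q
        obtain ⟨t, ht, u, htu⟩ := hore s' hs' r
        refine ⟨t * s, hm.2.1 _ ht _ hs, u * r', (hb.2.2 _ _ hr').1, ?_⟩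
        calc f (t * s) * (q * q') = f t * (f s * q) * q' := by simp only [map_mul, mul_assoc]
          _ = f (t * r) * q' := by rw [e1, map_mul]
          _ = f (u * r') := by rw [htu, map_mul, map_mul, mul_assoc, e1'] }
  have hLr : ∀ l ∈ L, ∀ a : A, l * f a ∈ L := by
    rintro l ⟨s, hs, r, hr, e⟩ a
    exact ⟨s, hs, r * a, (hb.2.2 _ _ hr).2, by rw [← mul_assoc, e, map_mul]⟩
  have hLi : ∀ l ∈ L, ∀ s ∈ S, ∃ l' ∈ L, l' * f s = l := by
    intro l hl s hs
    let m : L →ₗ[Q] L := ((LinearMap.toSpanSingleton Q Q (f s)).restrict (p := L) (q := L)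
      (fun x hx => by simpa using hLr x hx s))
    have hm : Function.Injective m := by
      rw [← LinearMap.ker_eq_bot, LinearMap.ker_eq_bot']
      intro x hx
      have : (x : Q) * f s = 0 := by simpa [m] using congrArg Subtype.val hx
      exact Subtype.ext ((h1 s hs).mul_left_eq_zero.mp this)
    obtain ⟨l', hl'⟩ := IsArtinian.surjective_of_injective_endomorphism m hm ⟨l, hl⟩
    exact ⟨l', l'.2, by simpa [m] using congrArg Subtype.val hl'⟩
  have hI : IsIdealSet (L : Set Q) := by
    refine ⟨L.zero_mem, fun x hx y hy => L.add_mem hx hy, fun q l hl => ⟨L.smul_mem q hl, ?_⟩⟩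
    obtain ⟨s, hs, r, e⟩ := h2 q
    obtain ⟨l', hl', e'⟩ := hLi l hl s hs
    have : l * q = l' * f r := by rw [← e', mul_assoc, e]
    rw [this]
    exact hLr _ hl' _
  have hyL : f y ∈ (L : Set Q) := ⟨1, hm.1, y, hy, by simp⟩
  rcases hQ.1.2 _ hI with h | h
  · rw [h] at hyL; exact absurd hyL hy0
  · have h1L : (1 : Q) ∈ (L : Set Q) := by rw [h]; trivial
    obtain ⟨s, hs, z, hz, e⟩ := h1L
    exact ⟨z, hz, by rw [← e, mul_one]; exact h1 s hs⟩

end Aux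

section Prod

variable {A : Type u} [Ring A]

/-- An element which is left regular modulo the kernel of a localization to an Artinian ring
becomes a unit. -/
theorem IsLeftLoc.isUnit_of_reg {D : Set A} {Q : Type u} [Ring Q] {f : A →+* Q}
    (h : IsLeftLoc D f) (hQ : IsArtinianRing Q) {t : A}
    (ht : ∀ x, f (x * t) = 0 → f x = 0) : IsUnit (f t) := by
  apply isUnit_of_lReg
  intro q hq
  obtain ⟨s, hs, r, e⟩ := h.2.1 q
  have : f (r * t) = 0 := by rw [map_mul, ← e, mul_assoc, hq, mul_zero]
  have := ht r this
  rw [this] at e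
  exact (h.1 s hs).mul_right_eq_zero.mp e

theorem isMulSet_isUnit {Q : Type u} [Ring Q] (h01 : (0 : Q) ≠ 1) (f : A →+* Q) :
    IsMulSet {r : A | IsUnit (f r)} := by
  have : Nontrivial Q := ⟨⟨0, 1, h01⟩⟩
  refine ⟨by simp, fun a ha b hb => ?_, by simp⟩
  simp only [Set.mem_ofPred_eq, map_mul] at *
  exact ha.mul hb

theorem IsLeftLoc.isUnit_set {D : Set A} {Q : Type u} [Ring Q] {f : A →+* Q}
    (h : IsLeftLoc D f) : IsLeftLoc {r : A | IsUnit (f r)} f := by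
  refine ⟨fun s hs => hs, fun q => ?_, fun r => ⟨fun hr => ?_, ?_⟩⟩
  · obtain ⟨s, hs, r, e⟩ := h.2.1 q
    exact ⟨s, h.1 s hs, r, e⟩
  · obtain ⟨s, hs, e⟩ := (h.2.2 r).mp hr
    exact ⟨s, h.1 s hs, e⟩
  · rintro ⟨s, hs, e⟩
    have : f s * f r = 0 := by rw [← map_mul, e, map_zero]
    exact (IsUnit.mul_right_eq_zero hs).mp this

theorem eq_isUnit_set {S : Set A} (hS : S ∈ maxLeftDenom A) {Q : Type u} [Ring Q] {f : A →+* Q}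
    (h : IsLeftLoc S f) (h01 : (0 : Q) ≠ 1) : S = {r : A | IsUnit (f r)} :=
  hS.2 _ (h.isUnit_set.isLeftDenom (isMulSet_isUnit h01 f)) h.1

/-- The separating elements for a finite family of maximal left denominator sets with simple
Artinian localizations. -/
theorem exists_separating {ι : Type u} [Finite ι] (S : ι → Set A) (hinj : Function.Injective S)
    (hS : ∀ i, S i ∈ maxLeftDenom A) (Q : ι → Type u) [∀ i, Ring (Q i)] (p : ∀ i, A →+* Q i)
    (hp : ∀ i, IsLeftLoc (S i) (p i)) (hQ : ∀ i, SimpleArtinianRing (Q i)) (i : ι) :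
    ∃ y : A, IsUnit (p i y) ∧ ∀ j, j ≠ i → p j y = 0 := by
  classical
  have hU : ∀ i, S i = {r : A | IsUnit (p i r)} := fun i =>
    eq_isUnit_set (hS i) (hp i) (hQ i).1.1
  have key : ∀ j, j ≠ i → ∃ x, IsUnit (p i x) ∧ p j x = 0 := by
    intro j hji
    have : ∃ x ∈ ass (S j), p i x ≠ 0 := by
      by_contra hcon
      push Not at hcon
      by_cases h2 : ∃ x ∈ ass (S i), p j x ≠ 0
      · obtain ⟨x, hx, hx0⟩ := h2
        obtain ⟨z, ⟨s, hs, hsz⟩, hzu⟩ := (hp j).exists_isUnit (hS j).1 (hQ j)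
          (ass_isIdealSet (hS i).1) hx hx0
        have e1 : p j s * p j z = 0 := by rw [← map_mul, hsz, map_zero]
        have e2 := hzu.mul_left_eq_zero.mp e1
        have e3 := hcon s (((hp j).2.2 s).mp e2)
        have e4 := (hp i).1 s hs
        rw [e3] at e4
        exact (hQ i).1.1 (isUnit_zero_iff.mp e4)
      · push Not at h2
        have hk : ∀ x, p i x = 0 ↔ p j x = 0 := fun x =>
          ⟨fun h => h2 x (((hp i).2.2 x).mp h), fun h => hcon x (((hp j).2.2 x).mp h)⟩
        have hsub : S i ⊆ S j := by
          intro r hr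
          rw [hU j]
          refine (hp j).isUnit_of_reg (hQ j).2 fun x hx => ?_
          rw [← hk, map_mul] at hx
          exact (hk x).mp (((hp i).1 r hr).mul_left_eq_zero.mp hx)
        exact hji (hinj ((hS i).2 _ (hS j).1 hsub)).symm
    obtain ⟨x, hx, hx0⟩ := this
    obtain ⟨z, hz, hzu⟩ := (hp i).exists_isUnit (hS i).1 (hQ i) (ass_isIdealSet (hS j).1) hx hx0
    exact ⟨z, hzu, ((hp j).2.2 z).mpr hz⟩
  have : Fintype ι := Fintype.ofFinite ι
  have hind : ∀ J : Finset ι, ∃ y : A, IsUnit (p i y) ∧ ∀ j ∈ J, j ≠ i → p j y = 0 := by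
    intro J
    induction J using Finset.induction_on with
    | empty => exact ⟨1, by simp, by simp⟩
    | insert k J hk ih =>
      obtain ⟨y, hy, hy0⟩ := ih
      by_cases hki : k = i
      · refine ⟨y, hy, fun j hj hji => ?_⟩
        rcases Finset.mem_insert.mp hj with rfl | hj
        · exact absurd hki hji
        · exact hy0 j hj hji
      · obtain ⟨x, hx, hx0⟩ := key k hki
        refine ⟨x * y, by rw [map_mul]; exact hx.mul hy, fun j hj hji => ?_⟩
        rw [map_mul]
        rcases Finset.mem_insert.mp hj with rfl | hj
        · rw [hx0, zero_mul]
        · rw [hy0 j hj hji, mul_zero]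
  obtain ⟨y, hy, hy0⟩ := hind Finset.univ
  exact ⟨y, hy, fun j hj => hy0 j (Finset.mem_univ j) hj⟩

/-- Every tuple of fractions has a common denominator. -/
theorem exists_common_denominator {ι : Type u} [Finite ι] (S : ι → Set A) (Q : ι → Type u)
    [∀ i, Ring (Q i)] (p : ∀ i, A →+* Q i) (hp : ∀ i, IsLeftLoc (S i) (p i))
    (hy : ∀ i, ∃ y : A, IsUnit (p i y) ∧ ∀ j, j ≠ i → p j y = 0) (q : ∀ i, Q i) :
    ∃ c r : A, ∀ i, IsUnit (p i c) ∧ p i c * q i = p i r := by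
  classical
  have : Fintype ι := Fintype.ofFinite ι
  choose y hyu hy0 using hy
  have hs : ∀ i, ∃ s ∈ S i, ∃ r : A, p i s * q i = p i r := fun i => (hp i).2.1 (q i)
  choose s hs r hr using hs
  have hsum : ∀ (g : ι → A) (i : ι), p i (∑ j, y j * g j) = p i (y i) * p i (g i) := by
    intro g i
    rw [map_sum, Finset.sum_eq_single i]
    · rw [map_mul]
    · intro j _ hj
      rw [map_mul, hy0 j i hj.symm, zero_mul]
    · simp
  refine ⟨∑ j, y j * s j, ∑ j, y j * r j, fun i => ⟨?_, ?_⟩⟩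
  · rw [hsum]; exact (hyu i).mul ((hp i).1 _ (hs i))
  · rw [hsum, hsum, mul_assoc, hr]

/-- The elements which become units in the `i`-th factor. -/
def unitSet {n : ℕ} {Q : Fin n → Type u} [∀ i, Ring (Q i)] (F : A →+* ∀ i, Q i) (i : Fin n) :
    Set A := {r : A | IsUnit (((Pi.evalRingHom Q i).comp F) r)}

variable {n : ℕ} {Q : Fin n → Type u} [∀ i, Ring (Q i)] {F : A →+* ∀ i, Q i} {D : Set A}

theorem prod_idem (hF : IsLeftLoc D F) (i : Fin n) :
    ∃ z : A, IsUnit (F z i) ∧ (∀ j, j ≠ i → F z j = 0) ∧ ∀ x, F x i = 0 → F (z * x) = 0 := by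
  classical
  obtain ⟨s, hs, z, e⟩ := hF.2.1 (Pi.single i 1)
  have hz : ∀ j, F z j = F s j * (Pi.single i (1 : Q i) : ∀ i, Q i) j := fun j => by
    rw [← e]; rfl
  have hz0 : ∀ j, j ≠ i → F z j = 0 := fun j hj => by rw [hz, Pi.single_eq_of_ne hj, mul_zero]
  refine ⟨z, ?_, hz0, fun x hx => ?_⟩
  · rw [hz]; simpa using (hF.1 s hs).map (Pi.evalRingHom Q i)
  · ext j
    rw [map_mul, Pi.mul_apply]
    by_cases hj : j = i
    · subst hj; rw [hx]; simp
    · rw [hz0 j hj]; simp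

theorem sub_unitSet (hF : IsLeftLoc D F) (i : Fin n) : D ⊆ unitSet F i :=
  fun s hs => (hF.1 s hs).map (Pi.evalRingHom Q i)

theorem unitSet_isMulSet (hQ : ∀ i, SimpleArtinianRing (Q i)) (i : Fin n) :
    IsMulSet (unitSet F i) := isMulSet_isUnit (hQ i).1.1 _

theorem unitSet_isLeftLoc (hF : IsLeftLoc D F) (i : Fin n) :
    IsLeftLoc (unitSet F i) ((Pi.evalRingHom Q i).comp F) := by
  classical
  refine ⟨fun s hs => hs, fun q => ?_, fun r => ⟨fun hr => ?_, ?_⟩⟩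
  · obtain ⟨s, hs, r, e⟩ := hF.2.1 (Pi.single i q)
    refine ⟨s, sub_unitSet hF i hs, r, ?_⟩
    have := congrFun e i
    simpa using this
  · obtain ⟨z, hz, hz0, hk⟩ := prod_idem hF i
    obtain ⟨d, hd, e⟩ := (hF.2.2 _).mp (hk r hr)
    refine ⟨d * z, ?_, by rw [mul_assoc, e]⟩
    have h1 := sub_unitSet hF i hd
    simp only [unitSet, Set.mem_ofPred_eq, map_mul] at *
    exact h1.mul hz
  · rintro ⟨s, hs, e⟩
    have : ((Pi.evalRingHom Q i).comp F) s * ((Pi.evalRingHom Q i).comp F) r = 0 := by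
      rw [← map_mul, e, map_zero]
    exact (IsUnit.mul_right_eq_zero hs).mp this

theorem mem_ass_unitSet (hF : IsLeftLoc D F) (i : Fin n) (r : A) :
    r ∈ ass (unitSet F i) ↔ F r i = 0 := ((unitSet_isLeftLoc hF i).2.2 r).symm

theorem unitSet_isLeftDenom (hF : IsLeftLoc D F) (hQ : ∀ i, SimpleArtinianRing (Q i))
    (i : Fin n) : IsLeftDenom (unitSet F i) :=
  (unitSet_isLeftLoc hF i).isLeftDenom (unitSet_isMulSet hQ i)

theorem eq_of_unitSet_sub (hF : IsLeftLoc D F) (hQ : ∀ i, SimpleArtinianRing (Q i))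
    {i j : Fin n} (h : unitSet F i ⊆ unitSet F j) : i = j := by
  by_contra hij
  obtain ⟨z, hz, hz0, -⟩ := prod_idem hF i
  have h1 : IsUnit (F z j) := h hz
  rw [hz0 j (fun h => hij h.symm)] at h1
  exact (hQ j).1.1 (isUnit_zero_iff.mp h1)

theorem exists_sub_unitSet (hF : IsLeftLoc D F) (hQ : ∀ i, SimpleArtinianRing (Q i))
    {T : Set A} (hT : IsLeftDenom T) (hDT : ass D ⊆ ass T) : ∃ i, T ⊆ unitSet F i := by
  classical
  have hb := ass_isIdealSet hT
  have hexi : ∃ i, ∀ y ∈ ass T, F y i = 0 := by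
    by_contra hcon
    push Not at hcon
    have h1 : ∀ i, ∃ w ∈ ass T, IsUnit (F w i) ∧ ∀ j, j ≠ i → F w j = 0 := by
      intro i
      obtain ⟨y, hy, hy0⟩ := hcon i
      obtain ⟨w, hw, hwu⟩ := (unitSet_isLeftLoc hF i).exists_isUnit (unitSet_isLeftDenom hF hQ i)
        (hQ i) hb hy hy0
      obtain ⟨z, hz, hz0, -⟩ := prod_idem hF i
      refine ⟨z * w, (hb.2.2 _ _ hw).1, ?_, fun j hj => ?_⟩
      · rw [map_mul]; exact hz.mul hwu
      · rw [map_mul, Pi.mul_apply, hz0 j hj, zero_mul]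
    choose w hw hwu hw0 using h1
    have hsum : ∀ i, F (∑ j, w j) i = F (w i) i := by
      intro i
      rw [map_sum, Finset.sum_apply, Finset.sum_eq_single i]
      · intro j _ hj
        exact hw0 j i hj.symm
      · simp
    have hmem : ∀ J : Finset (Fin n), ∑ j ∈ J, w j ∈ ass T := by
      intro J
      induction J using Finset.induction_on with
      | empty => simpa using hb.1
      | insert k J hk ih => rw [Finset.sum_insert hk]; exact hb.2.1 _ (hw k) _ ih
    obtain ⟨t, ht, e⟩ := hmem Finset.univ
    have ht0 : F t = 0 := by
      ext i
      have h2 : F t i * F (∑ j, w j) i = 0 := by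
        rw [← Pi.mul_apply, ← map_mul, e, map_zero, Pi.zero_apply]
      rw [hsum] at h2
      exact (hwu i).mul_left_eq_zero.mp h2
    obtain ⟨t', ht', e'⟩ := hDT ((hF.2.2 t).mp ht0)
    exact hT.1.1.2.2 (e' ▸ hT.1.1.2.1 _ ht' _ ht)
  obtain ⟨i, hi⟩ := hexi
  refine ⟨i, fun t ht => ?_⟩
  have := (hQ i).2
  refine isUnit_of_lReg fun x hx => ?_
  obtain ⟨s, hs, y, e⟩ := hF.2.1 (Pi.single i x)
  have hyj : ∀ j, F y j = F s j * (Pi.single i x : ∀ i, Q i) j := fun j => by rw [← e]; rfl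
  have hyt : F (y * t) = 0 := by
    ext j
    rw [map_mul, Pi.mul_apply, hyj]
    by_cases hj : j = i
    · subst hj
      have hx' : x * F t j = 0 := hx
      simp [mul_assoc, hx']
    · rw [Pi.single_eq_of_ne hj]; simp
  obtain ⟨t1, ht1, e1⟩ := hDT ((hF.2.2 _).mp hyt)
  rw [← mul_assoc] at e1
  obtain ⟨t2, ht2, e2⟩ := hT.2 _ t ht e1
  have hyT : y ∈ ass T := ⟨t2 * t1, hT.1.1.2.1 _ ht2 _ ht1, by rw [mul_assoc, e2]⟩
  have h0 := hi y hyT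
  rw [hyj, Pi.single_eq_same] at h0
  exact ((hF.1 s hs).map (Pi.evalRingHom Q i)).mul_right_eq_zero.mp h0

theorem ass_mono {S T : Set A} (h : S ⊆ T) : ass S ⊆ ass T := by
  rintro x ⟨s, hs, e⟩; exact ⟨s, h hs, e⟩

theorem unitSet_mem_max (hF : IsLeftLoc D F) (hQ : ∀ i, SimpleArtinianRing (Q i)) (i : Fin n) :
    unitSet F i ∈ maxLeftDenom A := by
  refine ⟨unitSet_isLeftDenom hF hQ i, fun T hT hsub => ?_⟩
  obtain ⟨j, hj⟩ := exists_sub_unitSet hF hQ hT (ass_mono ((sub_unitSet hF i).trans hsub))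
  obtain rfl := eq_of_unitSet_sub hF hQ (hsub.trans hj)
  exact hsub.antisymm hj

theorem exists_eq_unitSet (hF : IsLeftLoc D F) (hQ : ∀ i, SimpleArtinianRing (Q i))
    {T : Set A} (hT : T ∈ maxLeftDenom A) (hDT : ass D ⊆ ass T) : ∃ i, T = unitSet F i := by
  obtain ⟨i, hi⟩ := exists_sub_unitSet hF hQ hT.1 hDT
  exact ⟨i, hT.2 _ (unitSet_isLeftDenom hF hQ i) hi⟩

/-- The product decomposition. -/
theorem prod_ringEquiv (hF : IsLeftLoc D F) (hQ : ∀ i, SimpleArtinianRing (Q i))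
    (M : Set (Set A)) (hM : ∀ S, S ∈ M ↔ ∃ i, S = unitSet F i)
    (QS : M → Type u) [∀ S, Ring (QS S)] (fS : ∀ S : M, A →+* QS S)
    (hS : ∀ S, IsLeftLoc S.1 (fS S)) : Nonempty ((∀ i, Q i) ≃+* ∀ S, QS S) := by
  let g : Fin n → M := fun i => ⟨unitSet F i, (hM _).mpr ⟨i, rfl⟩⟩
  have hg : Function.Bijective g := by
    constructor
    · intro i j hij
      exact eq_of_unitSet_sub hF hQ (congrArg Subtype.val hij).le
    · rintro ⟨S, hSM⟩
      obtain ⟨i, hi⟩ := (hM S).mp hSM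
      exact ⟨i, Subtype.ext hi.symm⟩
  have he : ∀ i, Nonempty (Q i ≃+* QS (g i)) := fun i =>
    (unitSet_isLeftLoc hF i).ringEquiv (unitSet_isLeftDenom hF hQ i) (hS (g i))
  exact ⟨(RingEquiv.piCongrRight fun i => (he i).some).trans
    (RingEquiv.piCongrLeft QS (Equiv.ofBijective g hg))⟩

/-- Wedderburn-Artin. -/
theorem exists_prod {Q0 : Type u} [Ring Q0] [IsSemisimpleRing Q0] :
    ∃ (n : ℕ) (Q : Fin n → Type u) (_ : ∀ i, Ring (Q i)),
      (∀ i, SimpleArtinianRing (Q i)) ∧ Nonempty (Q0 ≃+* ∀ i, Q i) := by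
  obtain ⟨n, D, d, _, hd, ⟨e⟩⟩ := IsSemisimpleRing.exists_ringEquiv_pi_matrix_divisionRing Q0
  refine ⟨n, fun i => Matrix (Fin (d i)) (Fin (d i)) (D i), inferInstance, fun i => ?_, ⟨e⟩⟩
  have := hd i
  exact ⟨SimpleRing.of_isSimpleRing, inferInstance⟩

end Prod

section Main

variable {R : Type u} [Ring R]

/-- Passing to the quotient by the kernel of a left localization with Artinian target. -/
theorem IsLeftLoc.quot {C : Set R} {Q : Type u} [Ring Q] {f : R →+* Q} (h : IsLeftLoc C f)
    (hQ : IsArtinianRing Q) {Rb : Type u} [Ring Rb] {π : R →+* Rb} (hπ : IsQuotBy (ass C) π) :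
    ∃ fb : Rb →+* Q, (∀ r, fb (π r) = f r) ∧ Function.Injective fb ∧ IsLeftLoc (π '' C) fb ∧
      IsLeftLoc (reg Rb) fb ∧ π '' C ⊆ reg Rb ∧ DenseIn (π '' C) (reg Rb) := by
  obtain ⟨hsurj, hker⟩ := hπ
  have hk : ∀ r, π r = 0 ↔ f r = 0 := fun r => (hker r).trans (h.2.2 r).symm
  let fb : Rb →+* Q := π.liftOfRightInverse (Function.surjInv hsurj)
    (Function.rightInverse_surjInv hsurj) ⟨f, fun r hr => (hk r).mp hr⟩
  have hfb : ∀ r, fb (π r) = f r := fun r =>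
    RingHom.liftOfRightInverse_comp_apply π _ (Function.rightInverse_surjInv hsurj) _ r
  have hinj : Function.Injective fb := by
    rw [injective_iff_map_eq_zero]
    intro x hx
    obtain ⟨r, rfl⟩ := hsurj x
    rw [hfb] at hx
    exact (hk r).mpr hx
  have hC : π '' C ⊆ reg Rb := by
    rintro _ ⟨c, hc, rfl⟩
    have hu := h.1 c hc
    rw [← hfb] at hu
    constructor
    · intro x hx
      have := congrArg fb hx
      rw [map_mul, map_zero] at this
      exact (map_eq_zero_iff fb hinj).mp (hu.mul_left_eq_zero.mp this)
    · intro x hx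
      have := congrArg fb hx
      rw [map_mul, map_zero] at this
      exact (map_eq_zero_iff fb hinj).mp (hu.mul_right_eq_zero.mp this)
  have hreg : ∀ t ∈ reg Rb, IsUnit (fb t) := by
    intro t ht
    obtain ⟨t, rfl⟩ := hsurj t
    rw [hfb]
    refine h.isUnit_of_reg hQ fun x hx => ?_
    rw [← hk, map_mul] at hx
    rw [← hk]
    exact ht.1 _ hx
  have hass1 : ∀ x, fb x = 0 ↔ x ∈ ass (reg Rb) := by
    intro x
    constructor
    · intro hx
      rw [(map_eq_zero_iff fb hinj).mp hx]
      exact ⟨1, ⟨fun x hx => by simpa using hx, fun x hx => by simpa using hx⟩, by simp⟩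
    · rintro ⟨s, hs, e⟩
      rw [hs.2 x e, map_zero]
  refine ⟨fb, hfb, hinj, ⟨?_, ?_, ?_⟩, ⟨hreg, ?_, hass1⟩, hC, ?_⟩
  · intro t ht; exact hreg t (hC ht)
  · intro q
    obtain ⟨s, hs, r, e⟩ := h.2.1 q
    exact ⟨π s, ⟨s, hs, rfl⟩, π r, by rw [hfb, hfb, e]⟩
  · intro x
    constructor
    · intro hx
      obtain ⟨s, hs, -⟩ := h.2.1 0
      refine ⟨π s, ⟨s, hs, rfl⟩, ?_⟩
      rw [(map_eq_zero_iff fb hinj).mp hx, mul_zero]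
    · intro hx; exact (hass1 x).mpr (ass_mono hC hx)
  · intro q
    obtain ⟨s, hs, r, e⟩ := h.2.1 q
    exact ⟨π s, hC ⟨s, hs, rfl⟩, π r, by rw [hfb, hfb, e]⟩
  · intro t ht
    obtain ⟨u, hu⟩ := hreg t ht
    obtain ⟨s, hs, r, e⟩ := h.2.1 (↑u⁻¹)
    refine ⟨π r, s, hs, hinj ?_⟩
    rw [map_mul, hfb, hfb, ← e, ← hu]
    simp

theorem reg_isMulSet (A : Type u) [Ring A] (h : (0 : A) ≠ 1) : IsMulSet (reg A) := by
  refine ⟨⟨fun x hx => by simpa using hx, fun x hx => by simpa using hx⟩, ?_, ?_⟩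
  · intro a ha b hb
    exact ⟨fun x hx => ha.1 _ (hb.1 _ (by rw [mul_assoc, hx])),
      fun x hx => hb.2 _ (ha.2 _ (by rw [← mul_assoc, hx]))⟩
  · intro h0
    exact h (h0.1 1 (by simp)).symm

theorem lReg_isMulSet (A : Type u) [Ring A] (h : (0 : A) ≠ 1) : IsMulSet (lReg A) := by
  refine ⟨fun x hx => by simpa using hx, ?_, ?_⟩
  · intro a ha b hb
    exact fun x hx => ha _ (hb _ (by rw [mul_assoc, hx]))
  · intro h0
    exact h (h0 1 (by simp)).symm

/-- The implication (2) ⇒ (1). -/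
theorem two_imp_one
    (hfin : {S : Set R | S ∈ maxLeftDenom R ∧ lReg R ⊆ S}.Finite)
    (hne : {S : Set R | S ∈ maxLeftDenom R ∧ lReg R ⊆ S}.Nonempty)
    (hint : (⋂ S ∈ {S : Set R | S ∈ maxLeftDenom R ∧ lReg R ⊆ S}, ass S) = ass (lReg R))
    (hloc : ∀ S ∈ {S : Set R | S ∈ maxLeftDenom R ∧ lReg R ⊆ S},
         ∃ (Q : Type u) (_ : Ring Q) (f : R →+* Q), IsLeftLoc S f ∧ SimpleArtinianRing Q)
    {Rb : Type u} [Ring Rb] {π : R →+* Rb} (hπ : IsQuotBy (ass (lReg R)) π)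
    (hdense : DenseIn (π '' lReg R) (reg Rb)) :
    IsLeftDenom (lReg R) ∧ ∃ (Q : Type u) (_ : Ring Q) (f : R →+* Q),
      IsLeftLoc (lReg R) f ∧ IsSemisimpleRing Q := by
  have h01 : (0 : R) ≠ 1 := by
    obtain ⟨S, hS, -⟩ := hne
    intro h
    apply hS.1.1.1.2.2
    rw [h]
    exact hS.1.1.1.1
  set M : Set (Set R) := {S : Set R | S ∈ maxLeftDenom R ∧ lReg R ⊆ S} with hM
  have : Finite M := hfin
  have hloc' : ∀ S : M, ∃ (Q : Type u) (_ : Ring Q) (f : R →+* Q),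
    IsLeftLoc S.1 f ∧ SimpleArtinianRing Q := fun S => hloc S.1 S.2
  choose Q hR p hp hQ using hloc'
  have hy := exists_separating (fun S : M => S.1) Subtype.val_injective (fun S => S.2.1) Q p hp hQ
  have hker : ∀ x, (∀ S, p S x = 0) ↔ x ∈ ass (lReg R) := by
    intro x
    rw [← hint, Set.mem_iInter₂]
    constructor
    · intro h S hS; exact ((hp ⟨S, hS⟩).2.2 x).mp (h ⟨S, hS⟩)
    · intro h S; exact ((hp S).2.2 x).mpr (h S.1 S.2)
  have hF : IsLeftLoc (lReg R) (RingHom.pi p) := by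
    refine ⟨fun s hs => ?_, fun q => ?_, fun r => ?_⟩
    · rw [Pi.isUnit_iff]
      intro S
      exact (hp S).1 s (S.2.2 hs)
    · obtain ⟨c, r, hcr⟩ := exists_common_denominator (fun S : M => S.1) Q p hp hy q
      have hc : π c ∈ reg Rb := by
        constructor
        · intro x hx
          obtain ⟨x, rfl⟩ := hπ.1 x
          rw [← map_mul, hπ.2, ← hker] at hx
          rw [hπ.2, ← hker]
          intro S
          have := hx S
          rw [map_mul] at this
          exact (hcr S).1.mul_left_eq_zero.mp this
        · intro x hx
          obtain ⟨x, rfl⟩ := hπ.1 x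
          rw [← map_mul, hπ.2, ← hker] at hx
          rw [hπ.2, ← hker]
          intro S
          have := hx S
          rw [map_mul] at this
          exact (hcr S).1.mul_right_eq_zero.mp this
      obtain ⟨r', d, hd, e⟩ := hdense _ hc
      obtain ⟨r', rfl⟩ := hπ.1 r'
      have h0 : ∀ S, p S (d - r' * c) = 0 := by
        rw [hker, ← hπ.2, map_sub, map_mul, e, sub_self]
      refine ⟨d, hd, r' * r, ?_⟩
      funext S
      have h1 : p S d = p S r' * p S c := by
        have := h0 S
        rw [map_sub, sub_eq_zero, map_mul] at this
        exact this
      change p S d * q S = p S (r' * r)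
      rw [h1, mul_assoc, (hcr S).2, map_mul]
    · rw [← hker, funext_iff]
      rfl
  have hss : ∀ S, IsSemisimpleRing (Q S) := fun S => (hQ S).isSemisimpleRing
  exact ⟨hF.isLeftDenom (lReg_isMulSet R h01), _, _, _, hF, inferInstance⟩

end Main

theorem mem_M {R : Type u} [Ring R] {n : ℕ} {Q : Fin n → Type u} [∀ i, Ring (Q i)]
    {F : R →+* ∀ i, Q i} (hF : IsLeftLoc (lReg R) F) (hQ : ∀ i, SimpleArtinianRing (Q i))
    (S : Set R) : S ∈ {S : Set R | S ∈ maxLeftDenom R ∧ lReg R ⊆ S} ↔ ∃ i, S = unitSet F i := by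
  constructor
  · rintro ⟨hS, hCS⟩
    exact exists_eq_unitSet hF hQ hS (ass_mono hCS)
  · rintro ⟨i, rfl⟩
    exact ⟨unitSet_mem_max hF hQ i, sub_unitSet hF i⟩

/-- Theorem 3Mar15: semisimplicity criterion for `'Q_{l,cl}(R)` via the set
`'M = {S ∈ maxDen_l(R) | 'C_R ⊆ S}` of maximal left denominator sets containing `'C_R`,
together with the properties (a)-(d) that hold when the equivalent conditions hold. -/
theorem classicalLeftRegularLeftQuotient_semisimple_iff_maxDen {R : Type u} [Ring R] :
    -- (1) ↔ (2)
    ((IsLeftDenom (lReg R) ∧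
        ∃ (Q : Type u) (_ : Ring Q) (f : R →+* Q),
          IsLeftLoc (lReg R) f ∧ IsSemisimpleRing Q) ↔
      ({S : Set R | S ∈ maxLeftDenom R ∧ lReg R ⊆ S}.Finite ∧
       {S : Set R | S ∈ maxLeftDenom R ∧ lReg R ⊆ S}.Nonempty ∧
       (⋂ S ∈ {S : Set R | S ∈ maxLeftDenom R ∧ lReg R ⊆ S}, ass S) = ass (lReg R) ∧
       (∀ S ∈ {S : Set R | S ∈ maxLeftDenom R ∧ lReg R ⊆ S},
         ∃ (Q : Type u) (_ : Ring Q) (f : R →+* Q),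
           IsLeftLoc S f ∧ SimpleArtinianRing Q) ∧
       (∃ (Rb : Type u) (_ : Ring Rb) (π : R →+* Rb),
         IsQuotBy (ass (lReg R)) π ∧
         π '' lReg R ⊆ reg Rb ∧ DenseIn (π '' lReg R) (reg Rb)))) ∧
    -- Moreover, (a)-(d), when the equivalent conditions hold:
    ((IsLeftDenom (lReg R) ∧
        ∃ (Q : Type u) (_ : Ring Q) (f : R →+* Q),
          IsLeftLoc (lReg R) f ∧ IsSemisimpleRing Q) →
      (∃ (Rb : Type u) (_ : Ring Rb) (π : R →+* Rb), IsQuotBy (ass (lReg R)) π) ∧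
      ∀ (Rb : Type u) (_ : Ring Rb) (π : R →+* Rb), IsQuotBy (ass (lReg R)) π →
        -- (a): S ↦ π(S) is a bijection 'M → maxDen_l(R̄) with inverse T ↦ π⁻¹(T)
        ((∀ S ∈ {S : Set R | S ∈ maxLeftDenom R ∧ lReg R ⊆ S},
            π '' S ∈ maxLeftDenom Rb) ∧
         (∀ T ∈ maxLeftDenom Rb,
            π ⁻¹' T ∈ {S : Set R | S ∈ maxLeftDenom R ∧ lReg R ⊆ S}) ∧
         (∀ S ∈ {S : Set R | S ∈ maxLeftDenom R ∧ lReg R ⊆ S}, π ⁻¹' (π '' S) = S) ∧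
         (∀ T ∈ maxLeftDenom Rb, π '' (π ⁻¹' T) = T)) ∧
        -- (b)
        (∀ S ∈ {S : Set R | S ∈ maxLeftDenom R ∧ lReg R ⊆ S},
          ass (lReg R) ⊆ ass S ∧ π '' ass S = ass (π '' S)) ∧
        (∀ T ∈ maxLeftDenom Rb, π ⁻¹' (ass T) = ass (π ⁻¹' T)) ∧
        -- (c): S⁻¹R ≅ π(S)⁻¹R̄ is a simple Artinian ring
        (∀ S ∈ {S : Set R | S ∈ maxLeftDenom R ∧ lReg R ⊆ S},
          ∀ (Q1 : Type u) (_ : Ring Q1) (f1 : R →+* Q1), IsLeftLoc S f1 →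
            SimpleArtinianRing Q1 ∧
            ∀ (Q2 : Type u) (_ : Ring Q2) (f2 : Rb →+* Q2),
              IsLeftLoc (π '' S) f2 → Nonempty (Q1 ≃+* Q2)) ∧
        -- (d): 'Q ≅ ∏_{S ∈ 'M} S⁻¹R ≅ ∏_{T ∈ maxDen_l(R̄)} T⁻¹R̄ ≅ Q_{l,cl}(R̄)
        (∀ (Q0 : Type u) (_ : Ring Q0) (f0 : R →+* Q0), IsLeftLoc (lReg R) f0 →
          (∀ (QS : ↥{S : Set R | S ∈ maxLeftDenom R ∧ lReg R ⊆ S} → Type u)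
              [∀ S, Ring (QS S)]
              (fS : ∀ S : ↥{S : Set R | S ∈ maxLeftDenom R ∧ lReg R ⊆ S}, R →+* QS S),
            (∀ S, IsLeftLoc S.1 (fS S)) → Nonempty (Q0 ≃+* ∀ S, QS S)) ∧
          (∀ (QT : ↥(maxLeftDenom Rb) → Type u) [∀ T, Ring (QT T)]
              (fT : ∀ T : ↥(maxLeftDenom Rb), Rb →+* QT T),
            (∀ T, IsLeftLoc T.1 (fT T)) → Nonempty (Q0 ≃+* ∀ T, QT T)) ∧
          (∀ (Q3 : Type u) (_ : Ring Q3) (f3 : Rb →+* Q3),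
            IsLeftLoc (reg Rb) f3 → Nonempty (Q0 ≃+* Q3)))) := by
  refine ⟨⟨?_, ?_⟩, ?_⟩
  · rintro ⟨hC, Q0, _, f0, hf0, hss⟩
    obtain ⟨n, Q, _, hQ, ⟨e⟩⟩ := exists_prod (Q0 := Q0)
    have hF := hf0.comp_equiv e
    have hmem := mem_M hF hQ
    have hπ : IsQuotBy (ass (lReg R)) (Ideal.Quotient.mk (RingHom.ker f0)) :=
      ⟨Ideal.Quotient.mk_surjective, fun r => by
        rw [Ideal.Quotient.eq_zero_iff_mem, RingHom.mem_ker, hf0.2.2]⟩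
    obtain ⟨fb, -, -, -, -, h1, h2⟩ := hf0.quot inferInstance hπ
    refine ⟨?_, ?_, ?_, ?_, ⟨_, _, _, hπ, h1, h2⟩⟩
    · refine (Set.finite_range (unitSet ((e : Q0 →+* ∀ i, Q i).comp f0))).subset fun S hS => ?_
      obtain ⟨i, hi⟩ := (hmem S).mp hS
      exact ⟨i, hi.symm⟩
    · rcases Nat.eq_zero_or_pos n with rfl | hn
      · exfalso
        have h0 : ((e : Q0 →+* ∀ i, Q i).comp f0) 1 = 0 := Subsingleton.elim _ _
        obtain ⟨s, hs, e1⟩ := (hF.2.2 1).mp h0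
        rw [mul_one] at e1
        exact hC.1.1.2.2 (e1 ▸ hs)
      · exact ⟨_, (hmem _).mpr ⟨⟨0, hn⟩, rfl⟩⟩
    · ext r
      rw [Set.mem_iInter₂, ← hF.2.2, funext_iff]
      constructor
      · intro h i
        exact (mem_ass_unitSet hF i r).mp (h _ ((hmem _).mpr ⟨i, rfl⟩))
      · intro h S hS
        obtain ⟨i, rfl⟩ := (hmem S).mp hS
        exact (mem_ass_unitSet hF i r).mpr (h i)
    · intro S hS
      obtain ⟨i, rfl⟩ := (hmem S).mp hS
      exact ⟨Q i, _, _, unitSet_isLeftLoc hF i, hQ i⟩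
  · rintro ⟨hfin, hne, hint, hloc, Rb, _, π, hπ, -, hdense⟩
    exact two_imp_one hfin hne hint hloc hπ hdense
  · rintro ⟨hC, Q0, _, f0, hf0, hss⟩
    obtain ⟨n, Q, _, hQ, ⟨e⟩⟩ := exists_prod (Q0 := Q0)
    have hF := hf0.comp_equiv e
    have hmem := mem_M hF hQ
    refine ⟨⟨_, _, Ideal.Quotient.mk (RingHom.ker f0), Ideal.Quotient.mk_surjective, fun r => by
        rw [Ideal.Quotient.eq_zero_iff_mem, RingHom.mem_ker, hf0.2.2]⟩, ?_⟩
    intro Rb _ π hπ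
    have hsa : ∀ i, IsSemisimpleRing (Q i) := fun i => (hQ i).isSemisimpleRing
    obtain ⟨Fb, hFb, hinj, hFC, hFreg, hCreg, -⟩ := hF.quot inferInstance hπ
    have hmemb : ∀ T, T ∈ maxLeftDenom Rb ↔ ∃ i, T = unitSet Fb i := by
      intro T
      constructor
      · intro hT
        refine exists_eq_unitSet hFC hQ hT fun x hx => ?_
        have h0 : x = 0 := hinj (((hFC.2.2 x).mpr hx).trans (map_zero Fb).symm)
        exact ⟨1, hT.1.1.1.1, by rw [h0, mul_zero]⟩
      · rintro ⟨i, rfl⟩; exact unitSet_mem_max hFC hQ i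
    have hpre : ∀ i, π ⁻¹' (unitSet Fb i) = unitSet ((e : Q0 →+* ∀ i, Q i).comp f0) i := by
      intro i
      ext r
      change IsUnit (Fb (π r) i) ↔ IsUnit (_ : Q i)
      rw [hFb]
      rfl
    have himg : ∀ i, π '' (unitSet ((e : Q0 →+* ∀ i, Q i).comp f0) i) = unitSet Fb i := by
      intro i
      rw [← hpre, Set.image_preimage_eq _ hπ.1]
    have hpass : ∀ i, π ⁻¹' (ass (unitSet Fb i)) = ass (unitSet ((e : Q0 →+* ∀ i, Q i).comp f0) i) := by
      intro i
      ext r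
      rw [Set.mem_preimage, mem_ass_unitSet hFC, mem_ass_unitSet hF, hFb]
    have h01 : (0 : Rb) ≠ 1 := by
      intro h
      have h1 : π 1 = 0 := by rw [map_one, h]
      obtain ⟨s, hs, e1⟩ := (hπ.2 1).mp h1
      rw [mul_one] at e1
      exact hC.1.1.2.2 (e1 ▸ hs)
    refine ⟨⟨?_, ?_, ?_, ?_⟩, ?_, ?_, ?_, ?_⟩
    · intro S hS
      obtain ⟨i, rfl⟩ := (hmem S).mp hS
      rw [himg]; exact (hmemb _).mpr ⟨i, rfl⟩
    · intro T hT
      obtain ⟨i, rfl⟩ := (hmemb T).mp hT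
      rw [hpre]; exact (hmem _).mpr ⟨i, rfl⟩
    · intro S hS
      obtain ⟨i, rfl⟩ := (hmem S).mp hS
      rw [himg, hpre]
    · intro T hT
      exact Set.image_preimage_eq _ hπ.1
    · intro S hS
      refine ⟨ass_mono hS.2, ?_⟩
      obtain ⟨i, rfl⟩ := (hmem S).mp hS
      rw [himg, ← hpass, Set.image_preimage_eq _ hπ.1]
    · intro T hT
      obtain ⟨i, rfl⟩ := (hmemb T).mp hT
      rw [hpre, hpass]
    · intro S hS Q1 _ f1 hf1
      obtain ⟨i, rfl⟩ := (hmem S).mp hS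
      obtain ⟨e1⟩ := (unitSet_isLeftLoc hF i).ringEquiv (unitSet_isLeftDenom hF hQ i) hf1
      refine ⟨(hQ i).of_ringEquiv e1, ?_⟩
      intro Q2 _ f2 hf2
      rw [himg] at hf2
      obtain ⟨e2⟩ := (unitSet_isLeftLoc hFC i).ringEquiv (unitSet_isLeftDenom hFC hQ i) hf2
      exact ⟨e1.symm.trans e2⟩
    · intro Q0' _ f0' hf0'
      obtain ⟨e0⟩ := hf0'.ringEquiv hC hF
      refine ⟨?_, ?_, ?_⟩
      · intro QS _ fS hS
        obtain ⟨e1⟩ := prod_ringEquiv hF hQ _ hmem QS fS hS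
        exact ⟨e0.trans e1⟩
      · intro QT _ fT hT
        obtain ⟨e1⟩ := prod_ringEquiv hFC hQ _ hmemb QT fT hT
        exact ⟨e0.trans e1⟩
      · intro Q3 _ f3 hf3
        obtain ⟨e1⟩ := hFreg.ringEquiv (hFreg.isLeftDenom (reg_isMulSet Rb h01)) hf3
        exact ⟨e0.trans e1⟩

end Bavula
end

section
/- Let R be a ring, 'C = 'C_R, a = ass_R('C), R̄ = R/a and 'C̄ = {c + a | c ∈ 'C}. The following are equivalent: (1) 'C is a left denominator set of R and 'Q_{l,cl}(R) := 'C⁻¹R is a semisimple Artinian ring; (2) (a) a is a semiprime ideal of R and the set Min_R(a) of minimal primes over a is finite; (b) for each p ∈ Min_R(a), the ring R/p is a left Goldie ring; (c) the set 'C̄ is a dense subset of C_{R̄}. -/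
universe u

namespace Bavula

/-! ### Goldie's theorem -/

/-- No descending chain with non-essential steps. -/
def NoChain (A : Type u) [Ring A] (M : Type*) [AddCommGroup M] [Module A M] : Prop :=
  ¬ ∃ W : ℕ → Submodule A M, ∀ n, W (n + 1) ≤ W n ∧
    ∃ v ∈ W n, v ≠ 0 ∧ ∀ b : A, b • v ∈ W (n + 1) → b • v = 0

/-- Essential left ideal, elementwise. -/
def Ess {A : Type u} [Ring A] (I : Submodule A A) : Prop :=
  ∀ y : A, y ≠ 0 → ∃ b : A, b * y ∈ I ∧ b * y ≠ 0

/-- Left annihilator of an element as a left ideal. -/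
def lan {A : Type u} [Ring A] (z : A) : Submodule A A where
  carrier := {x | x * z = 0}
  add_mem' := by
    intro a b ha hb
    simp only [Set.mem_setOf_eq] at *
    rw [add_mul, ha, hb, add_zero]
  zero_mem' := by simp
  smul_mem' := by
    intro c x hx
    simp only [Set.mem_setOf_eq, smul_eq_mul] at *
    rw [mul_assoc, hx, mul_zero]

theorem mem_lan {A : Type u} [Ring A] {z x : A} : x ∈ lan z ↔ x * z = 0 := Iff.rfl

section Goldie

variable {A : Type u} [Ring A]

theorem lAnn_singleton (z : A) : lAnn {z} = {x : A | x * z = 0} := by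
  ext x; simp [lAnn]

/-- powers stabilise -/
theorem acc_pow (hacc : AccOnSets {B : Set A | ∃ X : Set A, B = lAnn X}) (z : A) :
    ∃ N : ℕ, ∀ n, N ≤ n → ∀ x : A, x * z ^ n = 0 → x * z ^ N = 0 := by
  obtain ⟨N, hN⟩ := hacc (fun n => lAnn {z ^ n}) (fun n => ⟨_, rfl⟩) (by
    intro n
    simp only [lAnn_singleton]
    intro x hx
    simp only [Set.mem_setOf_eq] at *
    rw [pow_succ, ← mul_assoc, hx, zero_mul])
  refine ⟨N, fun n hn x hx => ?_⟩
  have h := hN n hn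
  simp only [lAnn_singleton] at h
  have : x ∈ {x : A | x * z ^ n = 0} := hx
  rw [h] at this
  exact this

/-- maximal annihilators -/
theorem acc_max (hacc : AccOnSets {B : Set A | ∃ X : Set A, B = lAnn X}) (T : Set A)
    (hT : T.Nonempty) :
    ∃ u ∈ T, ∀ w ∈ T, (∀ x : A, x * u = 0 → x * w = 0) → ∀ x : A, x * w = 0 → x * u = 0 := by
  by_contra hcon
  push Not at hcon
  choose! g hg1 hg2 y hy1 hy2 using hcon
  obtain ⟨u0, hu0⟩ := hT
  let s : ℕ → A := fun n => g^[n] u0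
  have hs : ∀ n, s n ∈ T := by
    intro n
    induction n with
    | zero => exact hu0
    | succ n ih =>
      have : s (n + 1) = g (s n) := Function.iterate_succ_apply' g n u0
      rw [this]; exact hg1 _ ih
  have hss : ∀ n, s (n + 1) = g (s n) := fun n => Function.iterate_succ_apply' g n u0
  obtain ⟨N, hN⟩ := hacc (fun n => lAnn {s n}) (fun n => ⟨_, rfl⟩) (by
    intro n
    simp only [lAnn_singleton, hss]
    intro x hx
    exact hg2 _ (hs n) x hx)
  have h := hN (N + 1) (Nat.le_succ N)
  simp only [lAnn_singleton, hss] at h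
  have h1 : y (s N) ∈ {x : A | x * g (s N) = 0} := hy1 _ (hs N)
  rw [h] at h1
  exact hy2 _ (hs N) h1

theorem g1 (hsp : SemiprimeRing A)
    (hacc : AccOnSets {B : Set A | ∃ X : Set A, B = lAnn X}) (a : A)
    (ha : ∀ x, IsNilpotent (a * x)) : a = 0 := by
  by_contra hne
  obtain ⟨u, ⟨⟨y, rfl⟩, hu0⟩, hmax⟩ := acc_max hacc {u : A | (∃ y, u = a * y) ∧ u ≠ 0}
    ⟨a, ⟨1, by simp⟩, hne⟩
  apply hu0
  apply hsp
  intro x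
  set u := a * y with hu
  obtain ⟨n, hn⟩ := ha (y * x)
  have hn' : (u * x) ^ n * u = 0 := by rw [hu, mul_assoc a y x, hn, zero_mul]
  classical
  have hex : ∃ k, (u * x) ^ k * u = 0 := ⟨n, hn'⟩
  obtain ⟨k, hk, hkmin⟩ : ∃ k, (u * x) ^ k * u = 0 ∧ ∀ m < k, (u * x) ^ m * u ≠ 0 :=
    ⟨Nat.find hex, Nat.find_spec hex, fun m hm => Nat.find_min hex hm⟩
  cases k with
  | zero => simp at hk; exact absurd hk hu0
  | succ k =>
    have hw0 := hkmin k (Nat.lt_succ_self k)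
    refine hmax ((u * x) ^ k * u) ⟨?_, hw0⟩ ?_ (u * x) ?_
    · cases k with
      | zero => exact ⟨y, by simp [hu]⟩
      | succ k => exact ⟨y * x * (u * x) ^ k * u, by rw [pow_succ']; simp only [hu, mul_assoc]⟩
    · intro t ht
      cases k with
      | zero => simpa using ht
      | succ k => rw [pow_succ', mul_assoc, mul_assoc, ← mul_assoc t, ht, zero_mul]
    · rw [← mul_assoc, ← pow_succ']; exact hk

theorem g2 (hsp : SemiprimeRing A)
    (hacc : AccOnSets {B : Set A | ∃ X : Set A, B = lAnn X}) (r : A)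
    (hr : Ess (lan r)) : r = 0 := by
  apply g1 hsp hacc
  intro x
  obtain ⟨N, hN⟩ := acc_pow hacc (r * x)
  refine ⟨N, ?_⟩
  by_contra hne
  obtain ⟨b, hb, hb0⟩ := hr _ hne
  apply hb0
  apply hN (N + 1) (Nat.le_succ N)
  rw [mem_lan] at hb
  rw [pow_succ, ← mul_assoc, ← mul_assoc, hb, zero_mul]

theorem g3 (hsp : SemiprimeRing A)
    (hacc : AccOnSets {B : Set A | ∃ X : Set A, B = lAnn X}) (a : A) (ha : a ≠ 0) :
    ∃ t : A, t * a ≠ 0 ∧ ∀ x, x * (t * a) * (t * a) = 0 → x * (t * a) = 0 := by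
  have : ∃ x, ¬ IsNilpotent (a * x) := by
    by_contra hcon
    push Not at hcon
    exact ha (g1 hsp hacc a hcon)
  obtain ⟨x, hx⟩ := this
  have hz : ¬ IsNilpotent (x * a) := by
    rintro ⟨n, hn⟩
    apply hx
    refine ⟨n + 1, ?_⟩
    have : ∀ m, (a * x) ^ (m + 1) = a * (x * a) ^ m * x := by
      intro m
      induction m with
      | zero => simp
      | succ m ih => rw [pow_succ, ih, pow_succ]; simp only [mul_assoc]
    rw [this, hn, mul_zero, zero_mul]
  obtain ⟨N, hN⟩ := acc_pow hacc (x * a)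
  have he : (x * a) ^ N * x * a = (x * a) ^ (N + 1) := by rw [pow_succ]; simp only [mul_assoc]
  refine ⟨(x * a) ^ N * x, ?_, ?_⟩
  · rw [he]; intro h; exact hz ⟨_, h⟩
  · rw [he]
    intro y hy
    rw [mul_assoc, ← pow_add] at hy
    have := hN _ (by omega) y hy
    rw [pow_succ, ← mul_assoc, this, zero_mul]

theorem g4 (hsp : SemiprimeRing A)
    (hacc : AccOnSets {B : Set A | ∃ X : Set A, B = lAnn X}) (hnc : NoChain A A)
    (I : Submodule A A) (hI : Ess I) : ∃ c ∈ I, c ∈ lReg A := by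
  by_contra hcon
  push Not at hcon
  apply hnc
  have step : ∀ c : {c : A // c ∈ I ∧ ∀ x, x * c * c = 0 → x * c = 0},
      ∃ c' : {c : A // c ∈ I ∧ ∀ x, x * c * c = 0 → x * c = 0},
        lan c'.1 ≤ lan c.1 ∧ ∃ v ∈ lan c.1, v ≠ 0 ∧ ∀ b : A, b • v ∈ lan c'.1 → b • v = 0 := by
    rintro ⟨c, hcI, hc⟩
    have h1 := hcon c hcI
    simp only [lReg, Set.mem_setOf_eq, not_forall] at h1
    obtain ⟨x, hx, hx0⟩ := h1
    obtain ⟨d, hd, hd0⟩ := hI x hx0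
    obtain ⟨t, ht0, ht⟩ := g3 hsp hacc _ hd0
    set b := t * (d * x) with hb
    have hbI : b ∈ I := I.smul_mem t hd
    have hbc : b * c = 0 := by rw [hb, mul_assoc, mul_assoc, hx, mul_zero, mul_zero]
    have key : ∀ y, y * (c + b) = 0 → y * c = 0 ∧ y * b = 0 := by
      intro y hy
      have h2 : y * c * c = 0 := by
        have : y * (c + b) * c = y * c * c + y * (b * c) := by noncomm_ring
        rw [hy, hbc, zero_mul, mul_zero, add_zero] at this
        exact this.symm
      have h3 := hc y h2
      refine ⟨h3, ?_⟩
      rw [mul_add, h3, zero_add] at hy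
      exact hy
    refine ⟨⟨c + b, I.add_mem hcI hbI, ?_⟩, ?_, b, hbc, ht0, ?_⟩
    · intro y hy
      obtain ⟨h4, h5⟩ := key _ hy
      have h6 : y * c = 0 := by
        apply hc
        have : y * (c + b) * c = y * c * c + y * (b * c) := by noncomm_ring
        rw [h4, hbc, mul_zero, add_zero] at this
        exact this.symm
      have h7 : y * b = 0 := by
        apply ht
        rw [mul_add, h6, zero_add] at h5
        exact h5
      rw [mul_add, h6, h7, add_zero]
    · intro y hy
      exact (key y hy).1
    · intro y hy
      exact ht _ (key _ hy).2
  choose g hg using step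
  let s : ℕ → {c : A // c ∈ I ∧ ∀ x, x * c * c = 0 → x * c = 0} :=
    fun n => g^[n] ⟨0, I.zero_mem, by simp⟩
  refine ⟨fun n => lan (s n).1, fun n => ?_⟩
  have : s (n + 1) = g (s n) := Function.iterate_succ_apply' g n _
  simp only [this]
  exact hg (s n)

theorem g5 (hnc : NoChain A A) (c : A) (hc : c ∈ lReg A) : Ess (Submodule.span A {c}) := by
  intro y hy
  by_contra hcon
  push Not at hcon
  apply hnc
  have hcn : ∀ n, ∀ x, x * c ^ n = 0 → x = 0 := by
    intro n
    induction n with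
    | zero => simp
    | succ n ih =>
      intro x hx
      rw [pow_succ, ← mul_assoc] at hx
      exact ih _ (hc _ hx)
  refine ⟨fun n => Submodule.span A {c ^ n}, fun n => ⟨?_, y * c ^ n, ?_, ?_, ?_⟩⟩
  · rw [Submodule.span_singleton_le_iff_mem, Submodule.mem_span_singleton]
    exact ⟨c, by rw [pow_succ', smul_eq_mul]⟩
  · rw [Submodule.mem_span_singleton]; exact ⟨y, rfl⟩
  · intro h; exact hy (hcn n y h)
  · intro b hb
    rw [Submodule.mem_span_singleton] at hb
    obtain ⟨d, hd⟩ := hb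
    simp only [smul_eq_mul] at hd ⊢
    have h1 : (b * y - d * c) * c ^ n = 0 := by
      rw [sub_mul, mul_assoc, ← hd, pow_succ', mul_assoc, sub_self]
    have h2 := sub_eq_zero.1 (hcn n _ h1)
    have h3 := hcon b (by rw [Submodule.mem_span_singleton]; exact ⟨d, h2.symm⟩)
    rw [← mul_assoc, h3, zero_mul]

theorem Ess.mono {I J : Submodule A A} (hI : Ess I) (h : I ≤ J) : Ess J := by
  intro y hy
  obtain ⟨b, hb, hb0⟩ := hI y hy
  exact ⟨b, h hb, hb0⟩

theorem g6 (hsp : SemiprimeRing A)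
    (hacc : AccOnSets {B : Set A | ∃ X : Set A, B = lAnn X}) (hnc : NoChain A A)
    (c : A) (hc : c ∈ lReg A) : c ∈ reg A := by
  refine ⟨hc, fun r hr => g2 hsp hacc r ((g5 hnc c hc).mono ?_)⟩
  rw [Submodule.span_singleton_le_iff_mem]
  exact hr

theorem g4' (hsp : SemiprimeRing A)
    (hacc : AccOnSets {B : Set A | ∃ X : Set A, B = lAnn X}) (hnc : NoChain A A)
    (I : Submodule A A) (hI : Ess I) : ∃ c ∈ I, c ∈ reg A := by
  obtain ⟨c, h1, h2⟩ := g4 hsp hacc hnc I hI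
  exact ⟨c, h1, g6 hsp hacc hnc c h2⟩

theorem g7 (hsp : SemiprimeRing A)
    (hacc : AccOnSets {B : Set A | ∃ X : Set A, B = lAnn X}) (hnc : NoChain A A)
    (c : A) (hc : c ∈ reg A) (r : A) : ∃ t ∈ reg A, ∃ r' : A, t * r = r' * c := by
  let L : Submodule A A := (Submodule.span A {c}).comap (LinearMap.toSpanSingleton A A r)
  have hL : ∀ x, x ∈ L ↔ ∃ d, d * c = x * r := by
    intro x
    simp [L, Submodule.mem_span_singleton]
  obtain ⟨t, ht, htr⟩ := g4' hsp hacc hnc L (by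
    intro y hy
    by_cases hyr : y * r = 0
    · exact ⟨1, by rw [hL]; exact ⟨0, by simp [hyr]⟩, by simpa using hy⟩
    · obtain ⟨b, hb, hb0⟩ := g5 hnc c hc.1 _ hyr
      refine ⟨b, ?_, ?_⟩
      · rw [hL]
        rw [Submodule.mem_span_singleton] at hb
        obtain ⟨d, hd⟩ := hb
        exact ⟨d, by rw [mul_assoc]; exact hd⟩
      · intro h; apply hb0; rw [← mul_assoc, h, zero_mul])
  obtain ⟨d, hd⟩ := (hL t).1 ht
  exact ⟨t, htr, d, hd.symm⟩

end Goldie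



/-! ### Fractions -/

/-- Left fractions. -/
structure Frac {R : Type u} [Ring R] {Q : Type u} [Ring Q] (f : R →+* Q) (S : Set R) : Prop where
  mul : ∀ a ∈ S, ∀ b ∈ S, a * b ∈ S
  unit : ∀ s ∈ S, IsUnit (f s)
  frac : ∀ q : Q, ∃ s ∈ S, ∃ r : R, f s * q = f r

section FracSec

variable {R : Type u} [Ring R] {Q : Type u} [Ring Q] {f : R →+* Q} {S : Set R}

theorem Frac.common (h : Frac f S) (u v : Q) :
    ∃ s ∈ S, (∃ r, f s * u = f r) ∧ ∃ r, f s * v = f r := by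
  obtain ⟨s1, hs1, r1, h1⟩ := h.frac u
  obtain ⟨s2, hs2, r2, h2⟩ := h.frac (f s1 * v)
  refine ⟨s2 * s1, h.mul _ hs2 _ hs1, ⟨s2 * r1, ?_⟩, ⟨r2, ?_⟩⟩
  · rw [map_mul, mul_assoc, h1, map_mul]
  · rw [map_mul, mul_assoc, h2]

theorem Frac.cancel (h : Frac f S) {s : R} (hs : s ∈ S) {x : Q} (hx : f s * x = 0) : x = 0 :=
  ((h.unit s hs).mul_right_eq_zero).1 hx

theorem Frac.span_clear (h : Frac f S) (K : Submodule R R) (q : Q)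
    (hq : q ∈ Submodule.span Q (f '' (K : Set R))) : ∃ s ∈ S, ∃ k ∈ K, f s * q = f k := by
  induction hq using Submodule.span_induction with
  | mem x hx =>
    obtain ⟨k, hk, rfl⟩ := hx
    obtain ⟨s, hs, -⟩ := h.frac 0
    exact ⟨s, hs, s * k, K.smul_mem s hk, by rw [map_mul]⟩
  | zero =>
    obtain ⟨s, hs, -⟩ := h.frac 0
    exact ⟨s, hs, 0, K.zero_mem, by simp⟩
  | add x y _ _ hx hy =>
    obtain ⟨s1, hs1, k1, hk1, h1⟩ := hx
    obtain ⟨s2, hs2, k2, hk2, h2⟩ := hy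
    obtain ⟨u, hu⟩ := (h.unit s1 hs1).exists_left_inv
    obtain ⟨v, hv⟩ := (h.unit s2 hs2).exists_left_inv
    obtain ⟨t, ht, ⟨r1, e1⟩, ⟨r2, e2⟩⟩ := h.common u v
    refine ⟨t, ht, r1 * k1 + r2 * k2, K.add_mem (K.smul_mem _ hk1) (K.smul_mem _ hk2), ?_⟩
    rw [map_add, map_mul, map_mul, ← h1, ← h2, ← e1, ← e2, mul_add, mul_assoc (f t) u,
      ← mul_assoc u, hu, one_mul, mul_assoc (f t) v, ← mul_assoc v, hv, one_mul]
  | smul a x _ hx =>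
    obtain ⟨s1, hs1, k1, hk1, h1⟩ := hx
    obtain ⟨u, hu⟩ := (h.unit s1 hs1).exists_left_inv
    obtain ⟨t, ht, r1, e1⟩ := h.frac (a * u)
    refine ⟨t, ht, r1 * k1, K.smul_mem _ hk1, ?_⟩
    rw [map_mul, ← h1, ← e1, smul_eq_mul]
    have : x = u * f s1 * x := by rw [hu, one_mul]
    conv_lhs => rw [this]
    simp only [mul_assoc]

theorem exists_max_disjoint {A : Type u} [Ring A] (J : Submodule A A) :
    ∃ K : Submodule A A, Disjoint J K ∧ Ess (J ⊔ K) := by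
  obtain ⟨K, -, hK⟩ := zorn_le_nonempty₀ {K : Submodule A A | Disjoint J K} (by
    intro c hc hch y hy
    refine ⟨sSup c, ?_, fun z hz => le_sSup hz⟩
    change Disjoint J (sSup c)
    rw [DirectedOn.disjoint_sSup_right hch.directedOn]
    exact fun b hb => hc hb) ⊥ disjoint_bot_right
  refine ⟨K, hK.prop, ?_⟩
  intro y hy
  by_contra hcon
  push Not at hcon
  have hd : Disjoint J (K ⊔ Submodule.span A {y}) := by
    rw [Submodule.disjoint_def]
    intro x hxJ hx
    rw [Submodule.mem_sup] at hx
    obtain ⟨k, hk, z, hz, rfl⟩ := hx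
    obtain ⟨b, rfl⟩ := Submodule.mem_span_singleton.1 hz
    have h1 : b * y ∈ J ⊔ K := by
      have : b * y = (k + b • y) + (-k) := by simp
      rw [this]
      exact Submodule.add_mem_sup hxJ (K.neg_mem hk)
    have h2 := hcon b h1
    rw [smul_eq_mul, h2, add_zero] at hxJ ⊢
    exact Submodule.disjoint_def.1 hK.prop k hxJ hk
  have hle : K ⊔ Submodule.span A {y} ≤ K := hK.le_of_ge hd le_sup_left
  have hyK : y ∈ K := hle (Submodule.mem_sup_right (Submodule.mem_span_singleton_self y))
  have := hcon 1 (by rw [one_mul]; exact Submodule.mem_sup_right hyK)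
  rw [one_mul] at this
  exact hy this

theorem semisimple_of_frac {A : Type u} [Ring A] {g : A →+* Q} {S : Set A} (h : Frac g S)
    (hess : ∀ I : Submodule A A, Ess I → ∃ c ∈ I, IsUnit (g c)) :
    IsSemisimpleRing Q := by
  have : ComplementedLattice (Submodule Q Q) := by
    refine ⟨fun I => ?_⟩
    let J : Submodule A A :=
      { carrier := {x | g x ∈ I}
        add_mem' := by
          intro a b ha hb
          change g (a + b) ∈ I
          rw [map_add]; exact I.add_mem ha hb
        zero_mem' := by
          change g 0 ∈ I
          rw [map_zero]; exact I.zero_mem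
        smul_mem' := by
          intro c x hx
          change g (c * x) ∈ I
          rw [map_mul]; exact I.smul_mem _ hx }
    obtain ⟨K, hd, he⟩ := exists_max_disjoint J
    refine ⟨Submodule.span Q (g '' (K : Set A)), ?_, ?_⟩
    · rw [Submodule.disjoint_def]
      intro x hx hxK
      obtain ⟨s, hs, k, hk, e⟩ := h.span_clear K x hxK
      have hkJ : k ∈ J := by
        change g k ∈ I
        rw [← e]; exact I.smul_mem _ hx
      have := Submodule.disjoint_def.1 hd k hkJ hk
      rw [this, map_zero] at e
      exact h.cancel hs e
    · rw [codisjoint_iff, Submodule.eq_top_iff']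
      obtain ⟨c, hc, hu⟩ := hess _ he
      obtain ⟨u, hu⟩ := hu.exists_left_inv
      obtain ⟨j, hj, k, hk, rfl⟩ := Submodule.mem_sup.1 hc
      intro x
      have hx : x = (x * u) • (g j + g k) := by
        rw [← map_add, smul_eq_mul, mul_assoc, hu, mul_one]
      rw [hx]
      apply Submodule.smul_mem
      exact Submodule.add_mem_sup hj (Submodule.subset_span ⟨k, hk, rfl⟩)
  exact IsSemisimpleModule.mk

end FracSec

/-- Goldie's theorem. -/
theorem goldie {A : Type u} [Ring A] (hsp : SemiprimeRing A)
    (hacc : AccOnSets {B : Set A | ∃ X : Set A, B = lAnn X}) (hnc : NoChain A A) :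
    ∃ (Q : Type u) (_ : Ring Q) (g : A →+* Q), Function.Injective g ∧ Frac g (reg A) ∧
      IsSemisimpleRing Q := by
  let S : Submonoid A :=
    { carrier := reg A
      one_mem' := ⟨fun x hx => by simpa using hx, fun x hx => by simpa using hx⟩
      mul_mem' := by
        rintro a b ⟨ha1, ha2⟩ ⟨hb1, hb2⟩
        refine ⟨fun x hx => ha1 x (hb1 _ (by rw [mul_assoc]; exact hx)),
          fun x hx => hb2 x (ha2 _ (by rw [← mul_assoc]; exact hx))⟩ }
  have hore := g7 hsp hacc hnc
  choose! D hD N hN using hore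
  let _ : OreLocalization.OreSet S :=
    { ore_right_cancel := by
        rintro r1 r2 ⟨s, hs⟩ h
        refine ⟨1, ?_⟩
        have : r1 - r2 = 0 := hs.1 _ (by rw [sub_mul]; exact sub_eq_zero.2 h)
        rw [sub_eq_zero.1 this]
      oreNum := fun r s => N s r
      oreDenom := fun r s => ⟨D s r, hD s s.2 r⟩
      ore_eq := fun r s => hN s s.2 r }
  let g : A →+* OreLocalization S A :=
    { (OreLocalization.numeratorHom : A →* OreLocalization S A) with
      map_zero' := by
        change OreLocalization.numeratorHom (0 : A) = 0
        rw [OreLocalization.numeratorHom_apply, OreLocalization.zero_oreDiv]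
      map_add' := by
        intro x y
        change OreLocalization.numeratorHom (x + y) = OreLocalization.numeratorHom x +
          OreLocalization.numeratorHom y
        simp only [OreLocalization.numeratorHom_apply, OreLocalization.add_oreDiv] }
  have hgap : ∀ x, g x = OreLocalization.numeratorHom x := fun _ => rfl
  have hunit : ∀ s ∈ reg A, IsUnit (g s) := fun s hs => OreLocalization.numerator_isUnit ⟨s, hs⟩
  have hinj : Function.Injective g := by
    apply OreLocalization.numeratorHom_inj
    intro s hs
    rw [mem_nonZeroDivisorsLeft_iff]
    intro x hx
    exact hs.2 x hx
  have hfr : Frac g (reg A) := by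
    refine ⟨fun a ha b hb => S.mul_mem ha hb, hunit, ?_⟩
    intro q
    induction q using OreLocalization.ind with
    | _ r s =>
      refine ⟨s, s.2, r, ?_⟩
      rw [hgap, hgap, OreLocalization.numeratorHom_apply, OreLocalization.numeratorHom_apply,
        OreLocalization.mul_cancel]
  refine ⟨OreLocalization S A, inferInstance, g, hinj, hfr, ?_⟩
  apply semisimple_of_frac hfr
  intro I hI
  obtain ⟨c, hc, hc'⟩ := g4' hsp hacc hnc I hI
  exact ⟨c, hc, hunit c hc'⟩



/-! ### Finite uniform dimension -/

/-- A finite test family for essential submodules. -/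
def FinTest (A : Type u) [Ring A] (M : Type u) [AddCommGroup M] [Module A M] : Prop :=
  ∃ (κ : Type) (_ : Fintype κ) (w : κ → M), (∀ k, w k ≠ 0) ∧
    ∀ X : Submodule A M, (∀ k, ∃ a : A, a • w k ∈ X ∧ a • w k ≠ 0) →
      ∀ y, y ≠ 0 → ∃ a : A, a • y ∈ X ∧ a • y ≠ 0

theorem clear_bad {A : Type u} [Ring A] {M : Type u} [AddCommGroup M] [Module A M]
    {κ : Type*} [Fintype κ] (N : κ → Submodule A M)
    (hind : ∀ w : κ → M, (∀ k, w k ∈ N k) → ∑ k, w k = 0 → ∀ k, w k = 0)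
    (X : Submodule A M) (hX : ∀ k, ∀ z ∈ N k, z ≠ 0 → ∃ a : A, a • z ∈ X ∧ a • z ≠ 0) :
    ∀ (m : ℕ) (w : κ → M), (∀ k, w k ∈ N k) → ∑ k, w k ≠ 0 → {k | w k ∉ X}.ncard ≤ m →
      ∃ a : A, a • ∑ k, w k ∈ X ∧ a • ∑ k, w k ≠ 0 := by
  intro m
  induction m with
  | zero =>
    intro w hw h0 hc
    have h1 : {k | w k ∉ X} = ∅ := (Set.ncard_eq_zero (Set.toFinite _)).1 (Nat.le_zero.1 hc)
    refine ⟨1, ?_, by simpa using h0⟩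
    rw [one_smul]
    apply Submodule.sum_mem
    intro k _
    by_contra hk
    have : k ∈ {k | w k ∉ X} := hk
    rw [h1] at this
    exact this
  | succ m ih =>
    intro w hw h0 hc
    by_cases hbad : ∃ k, w k ∉ X
    · obtain ⟨k, hk⟩ := hbad
      have hk0 : w k ≠ 0 := fun h => hk (by rw [h]; exact X.zero_mem)
      obtain ⟨a, ha, ha0⟩ := hX k (w k) (hw k) hk0
      have e : ∑ j, a • w j = a • ∑ j, w j := Finset.smul_sum.symm
      have hw' : ∀ j, a • w j ∈ N j := fun j => (N j).smul_mem a (hw j)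
      obtain ⟨b, hb, hb0⟩ := ih (fun j => a • w j) hw' (fun h => ha0 (hind _ hw' h k)) (by
        have hlt : {j | a • w j ∉ X} ⊂ {j | w j ∉ X} := by
          refine ⟨fun j hj hjX => hj (X.smul_mem a hjX), fun hsub => ?_⟩
          exact hsub (show k ∈ {j | w j ∉ X} from hk) ha
        have := Set.ncard_lt_ncard hlt (Set.toFinite _)
        omega)
      refine ⟨b * a, ?_, ?_⟩
      · rw [mul_smul, ← e]; exact hb
      · rw [mul_smul, ← e]; exact hb0
    · push Not at hbad
      exact ⟨1, by rw [one_smul]; exact X.sum_mem fun k _ => hbad k, by rw [one_smul]; exact h0⟩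

theorem finTest_of_finUdim {B : Type u} [Ring B] (h : FinUdim B) : FinTest B B := by
  obtain ⟨n, U, hU, hdis, hess⟩ := h
  have hne : ∀ i, ∃ x ∈ U i, x ≠ 0 := fun i => (Submodule.ne_bot_iff _).1 (hU i).1
  choose w hw hw0 using hne
  refine ⟨Fin (n + 1), inferInstance, w, hw0, ?_⟩
  intro X hX y hy
  have h1 := hess (Submodule.span B {y}) (by rwa [Ne, Submodule.span_singleton_eq_bot])
  obtain ⟨z, hz, hz0⟩ := (Submodule.ne_bot_iff _).1 h1
  obtain ⟨hzU, hzy⟩ := hz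
  obtain ⟨b, rfl⟩ := Submodule.mem_span_singleton.1 hzy
  obtain ⟨φ, hφ, hsum⟩ := (Submodule.mem_iSup_iff_exists_finsupp U _).1 hzU
  have hsum' : ∑ k, φ k = b • y := by
    rw [← hsum, Finsupp.sum_fintype]
    intro i; rfl
  obtain ⟨a, ha, ha0⟩ := clear_bad U (by
      intro v hv hv0 k
      have hk : v k ∈ U k ⊓ (⨆ j, ⨆ (_ : j ≠ k), U j) := by
        refine ⟨hv k, ?_⟩
        have e : v k = - ∑ j ∈ Finset.univ.erase k, v j := by
          rw [← Finset.add_sum_erase _ _ (Finset.mem_univ k)] at hv0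
          exact eq_neg_of_add_eq_zero_left hv0
        rw [SetLike.mem_coe, e]
        apply Submodule.neg_mem
        apply Submodule.sum_mem
        intro j hj
        exact Submodule.mem_iSup_of_mem j
          (Submodule.mem_iSup_of_mem (Finset.ne_of_mem_erase hj) (hv j))
      rw [hdis k] at hk
      exact (Submodule.mem_bot B).1 hk) X (by
      intro k z hz hz0
      obtain ⟨c, hc, hc0⟩ := hX k
      have h2 := (hU k).2 (Submodule.span B {z}) (Submodule.span B {c • w k})
        (by rw [Submodule.span_singleton_le_iff_mem]; exact hz)
        (by rw [Submodule.span_singleton_le_iff_mem]; exact (U k).smul_mem _ (hw k))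
        (by rwa [Ne, Submodule.span_singleton_eq_bot])
        (by rwa [Ne, Submodule.span_singleton_eq_bot])
      obtain ⟨t, ⟨ht1, ht2⟩, ht0⟩ := (Submodule.ne_bot_iff _).1 h2
      obtain ⟨d, rfl⟩ := Submodule.mem_span_singleton.1 ht1
      obtain ⟨e, he⟩ := Submodule.mem_span_singleton.1 ht2
      exact ⟨d, by rw [← he]; exact X.smul_mem _ hc, ht0⟩) _ φ hφ
    (by rw [hsum']; exact hz0) le_rfl
  rw [hsum'] at ha ha0
  refine ⟨a * b, ?_, ?_⟩
  · rw [mul_smul]; exact ha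
  · rw [mul_smul]; exact ha0

theorem finTest_comp {A B : Type u} [Ring A] [Ring B] (ψ : A →+* B) (hψ : Function.Surjective ψ)
    (h : FinTest B B) : @FinTest A _ B _ (Module.compHom B ψ) := by
  let _ : Module A B := Module.compHom B ψ
  have hs : ∀ (a : A) (b : B), a • b = ψ a * b := fun _ _ => rfl
  obtain ⟨κ, i, w, hw, hX⟩ := h
  refine ⟨κ, i, w, hw, fun X hX' y hy => ?_⟩
  let X' : Submodule B B :=
    { carrier := X
      add_mem' := fun ha hb => X.add_mem ha hb
      zero_mem' := X.zero_mem
      smul_mem' := by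
        intro c x hx
        obtain ⟨a, rfl⟩ := hψ c
        exact X.smul_mem a hx }
  obtain ⟨b, hb, hb0⟩ := hX X' (fun k => by
    obtain ⟨a, ha, ha0⟩ := hX' k
    exact ⟨ψ a, ha, ha0⟩) y hy
  obtain ⟨a, rfl⟩ := hψ b
  exact ⟨a, hb, hb0⟩

theorem finTest_pi {A : Type u} [Ring A] {n : ℕ} (M : Fin n → Type u)
    [∀ i, AddCommGroup (M i)] [∀ i, Module A (M i)] (h : ∀ i, FinTest A (M i)) :
    FinTest A (∀ i, M i) := by
  classical
  choose κ hκ w hw0 hw using h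
  have _ := hκ
  refine ⟨Σ i, κ i, inferInstance, fun p => Pi.single p.1 (w p.1 p.2), ?_, ?_⟩
  · rintro ⟨i, k⟩
    simpa using hw0 i k
  · intro X hX y hy
    have hX' : ∀ i, ∀ z : M i, z ≠ 0 → ∃ a : A, (Pi.single i (a • z) : ∀ i, M i) ∈ X ∧ a • z ≠ 0 := by
      intro i z hz
      obtain ⟨a, ha, ha0⟩ := hw i (X.comap (LinearMap.single A M i)) (by
        intro k
        obtain ⟨a, ha, ha0⟩ := hX ⟨i, k⟩
        refine ⟨a, ?_, ?_⟩
        · simp only [Submodule.mem_comap, LinearMap.coe_single, Pi.single_smul]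
          exact ha
        · intro h0
          apply ha0
          simp only [← Pi.single_smul, h0, Pi.single_zero]) z hz
      exact ⟨a, ha, ha0⟩
    have hy' : ∑ i, (Pi.single i (y i) : ∀ i, M i) = y := Finset.univ_sum_single y
    have := clear_bad (fun i => LinearMap.range (LinearMap.single A M i)) (by
      intro v hv hv0 k
      choose z hz using hv
      have e : ∀ i, v i = Pi.single i (z i) := fun i => (hz i).symm
      simp only [e] at hv0
      rw [Finset.univ_sum_single] at hv0
      rw [e, hv0]; simp) X (by
      rintro k _ ⟨z, rfl⟩ h0
      obtain ⟨a, ha, ha0⟩ := hX' k z (by rintro rfl; simp at h0)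
      refine ⟨a, ?_, ?_⟩
      · simpa only [LinearMap.coe_single, ← Pi.single_smul] using ha
      · simpa only [LinearMap.coe_single, ← Pi.single_smul, Ne, Pi.single_eq_zero_iff] using ha0)
      _ (fun i => Pi.single i (y i)) (fun i => ⟨y i, rfl⟩) (by rw [hy']; exact hy) le_rfl
    rwa [hy'] at this

theorem noChain_of_finTest {A : Type u} [Ring A] {M : Type u} [AddCommGroup M] [Module A M]
    (h : FinTest A M) : NoChain A M := by
  classical
  obtain ⟨κ, hκ, w, hw0, hw⟩ := h
  rintro ⟨W, hW⟩
  have key : ∀ n, ∃ T : Finset κ, T.card = n ∧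
      ∀ x ∈ W n, x ∈ Submodule.span A (w '' (T : Set κ)) → x = 0 := by
    intro n
    induction n with
    | zero => exact ⟨∅, rfl, by intro x _ hx; simpa using hx⟩
    | succ n ih =>
      obtain ⟨T, hT, hd⟩ := ih
      obtain ⟨hle, v, hv, hv0, hvb⟩ := hW n
      set E := Submodule.span A (w '' (T : Set κ)) with hE
      by_cases hk : ∃ k, ∀ a : A, a • w k ∈ W (n + 1) ⊔ E → a • w k = 0
      · obtain ⟨k, hk⟩ := hk
        have hkT : k ∉ T := by
          intro hkT
          apply hw0 k
          have := hk 1 (by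
            rw [one_smul]
            exact Submodule.mem_sup_right (Submodule.subset_span ⟨k, hkT, rfl⟩))
          rwa [one_smul] at this
        refine ⟨insert k T, by rw [Finset.card_insert_of_notMem hkT, hT], ?_⟩
        intro x hx hxE
        rw [Finset.coe_insert, Set.image_insert_eq, Submodule.mem_span_insert] at hxE
        obtain ⟨a, z, hz, rfl⟩ := hxE
        have h1 := hk a (by
          have : a • w k = (a • w k + z) + (-z) := by simp
          rw [this]
          exact Submodule.add_mem_sup hx (E.neg_mem hz))
        rw [h1, zero_add] at hx ⊢
        exact hd z (hle hx) hz
      · exfalso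
        push Not at hk
        obtain ⟨a, ha, ha0⟩ := hw _ hk v hv0
        apply ha0
        apply hvb
        obtain ⟨x, hx, z, hz, e⟩ := Submodule.mem_sup.1 ha
        have hz0 : z = 0 := by
          apply hd z _ hz
          have : z = a • v - x := by rw [← e]; simp
          rw [this]
          exact (W n).sub_mem ((W n).smul_mem a hv) (hle hx)
        rw [← e, hz0, add_zero]
        exact hx
  obtain ⟨T, hT, -⟩ := key (Fintype.card κ + 1)
  have := Finset.card_le_univ T
  omega

theorem NoChain.of_injective {A : Type u} [Ring A] {M N : Type u} [AddCommGroup M] [Module A M]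
    [AddCommGroup N] [Module A N] (h : NoChain A M) (φ : N →ₗ[A] M) (hφ : Function.Injective φ) :
    NoChain A N := by
  rintro ⟨W, hW⟩
  apply h
  refine ⟨fun n => (W n).map φ, fun n => ?_⟩
  obtain ⟨hle, v, hv, hv0, hvb⟩ := hW n
  refine ⟨Submodule.map_mono hle, φ v, Submodule.mem_map_of_mem hv, ?_, ?_⟩
  · intro h0; exact hv0 (hφ (by rw [h0, map_zero]))
  · intro b hb
    rw [← map_smul] at hb ⊢
    obtain ⟨x, hx, e⟩ := hb
    rw [hφ e] at hx
    rw [hvb b hx, map_zero]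

theorem noChain_of_family {A : Type u} [Ring A] {n : ℕ} (B : Fin n → Type u) [∀ i, Ring (B i)]
    (ψ : ∀ i, A →+* B i) (hs : ∀ i, Function.Surjective (ψ i))
    (hker : ∀ x, (∀ i, ψ i x = 0) → x = 0) (hB : ∀ i, LeftGoldie (B i)) : NoChain A A := by
  let _ : ∀ i, Module A (B i) := fun i => Module.compHom (B i) (ψ i)
  have h1 : FinTest A (∀ i, B i) :=
    finTest_pi B fun i => finTest_comp (ψ i) (hs i) (finTest_of_finUdim (hB i).2)
  let φ : A →ₗ[A] (∀ i, B i) :=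
    { toFun := fun a i => ψ i a
      map_add' := by intro x y; ext i; simp
      map_smul' := by
        intro c x; ext i
        change ψ i (c * x) = ψ i c * ψ i x
        rw [map_mul] }
  refine (noChain_of_finTest h1).of_injective φ ?_
  rw [injective_iff_map_eq_zero]
  intro a ha
  exact hker a fun i => congrFun ha i

theorem acc_of_family {A : Type u} [Ring A] {n : ℕ} (B : Fin n → Type u) [∀ i, Ring (B i)]
    (ψ : ∀ i, A →+* B i)
    (hker : ∀ x, (∀ i, ψ i x = 0) → x = 0) (hB : ∀ i, LeftGoldie (B i)) :
    AccOnSets {B : Set A | ∃ X : Set A, B = lAnn X} := by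
  intro F hF hmono
  have hmono' : ∀ m k, m ≤ k → F m ⊆ F k := fun m k h => monotone_nat_of_le_succ hmono h
  have h1 : ∀ i, ∃ N, ∀ k, N ≤ k → lAnn (ψ i '' rAnn (F k)) = lAnn (ψ i '' rAnn (F N)) := by
    intro i
    refine (hB i).1 (fun k => lAnn (ψ i '' rAnn (F k))) (fun k => ⟨_, rfl⟩) ?_
    rintro k b hb _ ⟨x, hx, rfl⟩
    exact hb _ ⟨x, fun y hy => hx y (hmono k hy), rfl⟩
  choose N hN using h1
  let N0 := Finset.univ.sup N
  have hN0 : ∀ i, N i ≤ N0 := fun i => Finset.le_sup (Finset.mem_univ i)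
  refine ⟨N0, fun k hk => ?_⟩
  apply Set.Subset.antisymm _ (hmono' _ _ hk)
  intro x hx
  obtain ⟨X, hXe⟩ := hF N0
  rw [hXe]
  intro z hz
  have hz' : z ∈ rAnn (F N0) := by
    intro y hy
    rw [hXe] at hy
    exact hy z hz
  apply hker
  intro i
  have h2 : ψ i x ∈ lAnn (ψ i '' rAnn (F k)) := by
    rintro _ ⟨t, ht, rfl⟩
    rw [← map_mul, ht x hx, map_zero]
  rw [hN i k ((hN0 i).trans hk), ← hN i N0 (hN0 i)] at h2
  rw [map_mul]
  exact h2 _ ⟨z, hz', rfl⟩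



/-! ### Minimal primes -/

section Primes

variable {R : Type u} [Ring R]

theorem exists_prime_notMem {a : Set R} (ha : IsSemiprimeIdealSet a) (x : R) (hx : x ∉ a) :
    ∃ p, IsPrimeIdealSet p ∧ a ⊆ p ∧ x ∉ p := by
  obtain ⟨hid, hsp⟩ := ha
  have h1 : ∀ y : R, y ∉ a → ∃ r : R, y * r * y ∉ a := by
    intro y hy
    by_contra hcon
    push Not at hcon
    exact hy (hsp y hcon)
  choose! r hr using h1
  let s : ℕ → R := fun n => (fun y => y * r y * y)^[n] x
  have hs0 : s 0 = x := rfl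
  have hss : ∀ n, s (n + 1) = s n * r (s n) * s n :=
    fun n => Function.iterate_succ_apply' (fun y => y * r y * y) n x
  have hsa : ∀ n, s n ∉ a := by
    intro n
    induction n with
    | zero => exact hx
    | succ n ih => rw [hss]; exact hr _ ih
  have hleft : ∀ m k, ∃ t, s (m + k) = t * s m := by
    intro m k
    induction k with
    | zero => exact ⟨1, by simp⟩
    | succ k ih =>
      obtain ⟨t, ht⟩ := ih
      refine ⟨s (m + k) * r (s (m + k)) * t, ?_⟩
      rw [← add_assoc, hss, mul_assoc (s (m + k) * r (s (m + k))) t, ← ht]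
  have hright : ∀ m k, ∃ t, s (m + k) = s m * t := by
    intro m k
    induction k with
    | zero => exact ⟨1, by simp⟩
    | succ k ih =>
      obtain ⟨t, ht⟩ := ih
      refine ⟨t * (r (s (m + k)) * s (m + k)), ?_⟩
      rw [← add_assoc, hss, ← mul_assoc (s m) t, ← ht, mul_assoc]
  obtain ⟨p, hap, hp⟩ := zorn_subset_nonempty
    {p : Set R | IsIdealSet p ∧ ∀ n, s n ∉ p} (by
      intro c hc hch hne
      refine ⟨⋃₀ c, ⟨⟨?_, ?_, ?_⟩, ?_⟩, fun t ht => Set.subset_sUnion_of_mem ht⟩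
      · obtain ⟨q, hq⟩ := hne
        exact ⟨q, hq, (hc hq).1.1⟩
      · rintro y ⟨q1, hq1, hy⟩ z ⟨q2, hq2, hz⟩
        rcases hch.total hq1 hq2 with h | h
        · exact ⟨q2, hq2, (hc hq2).1.2.1 _ (h hy) _ hz⟩
        · exact ⟨q1, hq1, (hc hq1).1.2.1 _ hy _ (h hz)⟩
      · rintro t y ⟨q, hq, hy⟩
        exact ⟨⟨q, hq, ((hc hq).1.2.2 t y hy).1⟩, ⟨q, hq, ((hc hq).1.2.2 t y hy).2⟩⟩
      · rintro n ⟨q, hq, hy⟩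
        exact (hc hq).2 n hy) a ⟨hid, hsa⟩
  obtain ⟨⟨hpi, hps⟩, hmax⟩ := hp
  have hmeet : ∀ J : Set R, IsIdealSet J → p ⊆ J → ∀ y ∈ J, y ∉ p → ∃ n, s n ∈ J := by
    intro J hJ hpJ y hyJ hyp
    by_contra hcon
    push Not at hcon
    exact hyp (hmax ⟨hJ, hcon⟩ hpJ hyJ)
  refine ⟨p, ⟨hpi, ?_, ?_⟩, hap, hps 0⟩
  · intro h
    apply hps 0
    rw [h]; trivial
  · intro y z hyz
    by_contra hcon
    push Not at hcon
    obtain ⟨hy, hz⟩ := hcon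
    obtain ⟨m, hm⟩ := hmeet {t | ∀ r, y * r * t ∈ p} (by
      refine ⟨fun r => by rw [mul_zero]; exact hpi.1, fun u hu v hv r => ?_, fun t u hu => ⟨?_, ?_⟩⟩
      · rw [mul_add]; exact hpi.2.1 _ (hu r) _ (hv r)
      · intro r
        have := hu (r * t)
        simpa only [mul_assoc] using this
      · intro r
        have := (hpi.2.2 t _ (hu r)).2
        simpa only [mul_assoc] using this)
      (fun t ht r => (hpi.2.2 _ t ht).1) z hyz hz
    obtain ⟨k, hk⟩ := hmeet {t | ∀ r, t * r * s m ∈ p} (by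
      refine ⟨fun r => by rw [zero_mul, zero_mul]; exact hpi.1, fun u hu v hv r => ?_,
        fun t u hu => ⟨?_, ?_⟩⟩
      · rw [add_mul, add_mul]; exact hpi.2.1 _ (hu r) _ (hv r)
      · intro r
        have := (hpi.2.2 t _ (hu r)).1
        simpa only [mul_assoc] using this
      · intro r
        have := hu (t * r)
        simpa only [mul_assoc] using this)
      (fun t ht r => by rw [mul_assoc]; exact (hpi.2.2 _ t ht).2) y hm hy
    obtain ⟨t1, ht1⟩ := hleft m k
    obtain ⟨t2, ht2⟩ := hright k m
    apply hps (m + k + 1)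
    rw [hss]
    have e : s (m + k) * r (s (m + k)) * s (m + k) = s k * (t2 * r (s (m + k)) * t1) * s m := by
      have ht2' : s (m + k) = s k * t2 := by rw [add_comm]; exact ht2
      calc s (m + k) * r (s (m + k)) * s (m + k)
          = (s k * t2) * r (s (m + k)) * (t1 * s m) := by rw [← ht2', ← ht1]
        _ = _ := by simp only [mul_assoc]
    rw [e]
    exact hk _

theorem exists_minPrime_notMem {a : Set R} (ha : IsSemiprimeIdealSet a) (x : R) (hx : x ∉ a) :
    ∃ p ∈ minPrimesOver a, x ∉ p := by
  obtain ⟨p, hp, hap, hxp⟩ := exists_prime_notMem ha x hx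
  obtain ⟨q, hqp, hq⟩ := zorn_superset_nonempty {q : Set R | IsPrimeIdealSet q ∧ a ⊆ q} (by
    intro c hc hch hne
    refine ⟨⋂₀ c, ⟨⟨⟨?_, ?_, ?_⟩, ?_, ?_⟩, ?_⟩, fun t ht => Set.sInter_subset_of_mem ht⟩
    · intro q hq; exact (hc hq).1.1.1
    · intro y hy z hz q hq
      exact (hc hq).1.1.2.1 _ (hy q hq) _ (hz q hq)
    · intro t y hy
      exact ⟨fun q hq => ((hc hq).1.1.2.2 t y (hy q hq)).1,
        fun q hq => ((hc hq).1.1.2.2 t y (hy q hq)).2⟩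
    · intro h
      obtain ⟨q, hq⟩ := hne
      apply (hc hq).1.2.1
      rw [Set.eq_univ_iff_forall] at h ⊢
      exact fun y => h y q hq
    · intro y z hyz
      by_contra hcon
      simp only [Set.mem_sInter, not_or, not_forall] at hcon
      obtain ⟨⟨q1, hq1, hy⟩, ⟨q2, hq2, hz⟩⟩ := hcon
      rcases hch.total hq1 hq2 with h | h
      · rcases (hc hq1).1.2.2 y z (fun r => hyz r q1 hq1) with h' | h'
        · exact hy h'
        · exact hz (h h')
      · rcases (hc hq2).1.2.2 y z (fun r => hyz r q2 hq2) with h' | h'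
        · exact hy (h h')
        · exact hz h'
    · intro y hy q hq
      exact (hc hq).2 hy) p ⟨hp, hap⟩
  refine ⟨q, ⟨hq.prop.1, hq.prop.2, ?_⟩, fun h => hxp (hqp h)⟩
  intro q' hq' haq' hle
  exact Set.Subset.antisymm hle (hq.le_of_le ⟨hq', haq'⟩ hle)

end Primes

theorem dir2 {R : Type u} [Ring R] [Nontrivial R]
    (ha : IsSemiprimeIdealSet (ass (lReg R)))
    (hfin : (minPrimesOver (ass (lReg R))).Finite)
    (hb : ∀ p ∈ minPrimesOver (ass (lReg R)),
       ∃ (Rp : Type u) (_ : Ring Rp) (πp : R →+* Rp),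
         IsQuotBy p πp ∧ LeftGoldie Rp)
    (Rb : Type u) [Ring Rb] (π : R →+* Rb) (hπ : IsQuotBy (ass (lReg R)) π)
    (hreg : π '' lReg R ⊆ reg Rb) (hdense : DenseIn (π '' lReg R) (reg Rb)) :
    IsLeftDenom (lReg R) ∧
      ∃ (Q : Type u) (_ : Ring Q) (f : R →+* Q),
        IsLeftLoc (lReg R) f ∧ IsSemisimpleRing Q := by
  obtain ⟨n, e, he⟩ : ∃ (n : ℕ) (e : Fin n → Set R), Set.range e = minPrimesOver (ass (lReg R)) := by
    obtain ⟨n, e, -, h⟩ := hfin.fin_param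
    exact ⟨n, e, h⟩
  have hmem : ∀ i, e i ∈ minPrimesOver (ass (lReg R)) := fun i => he ▸ Set.mem_range_self i
  choose B hB πB hπB hG using fun i => hb (e i) (hmem i)
  have hle : ∀ i, RingHom.ker π ≤ RingHom.ker (πB i) := by
    intro i x hx
    rw [RingHom.mem_ker] at hx ⊢
    rw [(hπB i).2]
    exact (hmem i).2.1 ((hπ.2 x).1 hx)
  let ψ : ∀ i, Rb →+* B i := fun i => RingHom.liftOfSurjective π hπ.1 ⟨πB i, hle i⟩
  have hψ : ∀ i x, ψ i (π x) = πB i x := fun i x =>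
    RingHom.liftOfRightInverse_comp_apply π _ (Function.rightInverse_surjInv hπ.1) ⟨πB i, hle i⟩ x
  have hψs : ∀ i, Function.Surjective (ψ i) := by
    intro i y
    obtain ⟨x, rfl⟩ := (hπB i).1 y
    exact ⟨π x, hψ i x⟩
  have hker : ∀ x, (∀ i, ψ i x = 0) → x = 0 := by
    intro x hx
    obtain ⟨x, rfl⟩ := hπ.1 x
    rw [hπ.2]
    by_contra hxa
    obtain ⟨p, hp, hxp⟩ := exists_minPrime_notMem ha x hxa
    rw [← he] at hp
    obtain ⟨i, rfl⟩ := hp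
    have := hx i
    rw [hψ, (hπB i).2] at this
    exact hxp this
  have hsp : SemiprimeRing Rb := by
    intro x hx
    obtain ⟨x, rfl⟩ := hπ.1 x
    rw [hπ.2]
    apply ha.2
    intro r
    rw [← hπ.2, map_mul, map_mul]
    exact hx _
  obtain ⟨Q, hQ, g, hinj, hfr, hss⟩ := goldie hsp (acc_of_family B ψ hker hG)
    (noChain_of_family B ψ hψs hker hG)
  have hmul : ∀ a ∈ lReg R, ∀ b ∈ lReg R, a * b ∈ lReg R :=
    fun a ha b hb x hx => ha x (hb _ (by rw [mul_assoc]; exact hx))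
  have hden : ∀ q : Q, ∃ s ∈ lReg R, ∃ r : R, g (π s) * q = g (π r) := by
    intro q
    obtain ⟨t, ht, r, hr⟩ := hfr.frac q
    obtain ⟨w, c, hc, hw⟩ := hdense t ht
    obtain ⟨y, hy⟩ := hπ.1 (w * r)
    refine ⟨c, hc, y, ?_⟩
    rw [hw, hy, map_mul, mul_assoc, hr, map_mul]
  have hunit : ∀ s ∈ lReg R, IsUnit (g (π s)) := fun s hs => hfr.unit _ (hreg ⟨s, hs, rfl⟩)
  refine ⟨⟨⟨⟨?_, hmul, ?_⟩, ?_⟩, ?_⟩, Q, hQ, g.comp π, ⟨hunit, hden, ?_⟩, hss⟩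
  · intro x hx; simpa using hx
  · intro h0
    exact one_ne_zero (h0 1 (mul_zero 1))
  · intro s hs r
    obtain ⟨v, hv⟩ := (hunit s hs).exists_left_inv
    obtain ⟨c, hc, y, hy⟩ := hden (g (π r) * v)
    have h1 : g (π (c * r - y * s)) = 0 := by
      simp only [map_sub, map_mul]
      rw [← hy, mul_assoc, mul_assoc, hv, mul_one, sub_self]
    have h2 : π (c * r - y * s) = 0 := hinj (by rw [h1, map_zero])
    obtain ⟨c', hc', h3⟩ := (hπ.2 _).1 h2
    refine ⟨c' * c, hmul _ hc' _ hc, c' * y, ?_⟩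
    rw [mul_sub, sub_eq_zero] at h3
    rw [mul_assoc, h3, mul_assoc]
  · intro r s hs h
    exact ⟨1, fun x hx => by simpa using hx, by rw [hs r h, mul_zero]⟩
  · intro r
    rw [← hπ.2]
    constructor
    · intro h
      exact hinj (by rw [map_zero]; exact h)
    · intro h
      change g (π r) = 0
      rw [h, map_zero]



/-! ### From the quotient ring to the Goldie conditions -/

section Converse

variable {R : Type u} [Ring R] {Q : Type u} [Ring Q] {f : R →+* Q} {S : Set R}

/-- Contraction of a left ideal. -/
def contr (f : R →+* Q) (I : Submodule Q Q) : Submodule R R where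
  carrier := {x | f x ∈ I}
  add_mem' := by
    intro a b ha hb
    change f (a + b) ∈ I
    rw [map_add]; exact I.add_mem ha hb
  zero_mem' := by
    change f 0 ∈ I
    rw [map_zero]; exact I.zero_mem
  smul_mem' := by
    intro c x hx
    change f (c * x) ∈ I
    rw [map_mul]; exact I.smul_mem _ hx

theorem mem_contr {I : Submodule Q Q} {x : R} : x ∈ contr f I ↔ f x ∈ I := Iff.rfl

theorem Frac.span_right [IsArtinianRing Q] (h : Frac f S) (J : Submodule R R)
    (hJ : ∀ x ∈ J, ∀ r, x * r ∈ J) (z q : Q)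
    (hz : z ∈ Submodule.span Q (f '' (J : Set R))) :
    z * q ∈ Submodule.span Q (f '' (J : Set R)) := by
  set E := Submodule.span Q (f '' (J : Set R)) with hE
  have h1 : ∀ r : R, ∀ z ∈ E, z * f r ∈ E := by
    intro r z hz
    induction hz using Submodule.span_induction with
    | mem x hx =>
      obtain ⟨k, hk, rfl⟩ := hx
      exact Submodule.subset_span ⟨k * r, hJ k hk r, by rw [map_mul]⟩
    | zero => rw [zero_mul]; exact E.zero_mem
    | add x y _ _ hx hy => rw [add_mul]; exact E.add_mem hx hy
    | smul a x _ hx => rw [smul_mul_assoc]; exact E.smul_mem _ hx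
  obtain ⟨s, hs, r, hr⟩ := h.frac q
  let φ : E →ₗ[Q] E :=
    { toFun := fun z => ⟨z.1 * f s, h1 s z.1 z.2⟩
      map_add' := by intro x y; ext; simp [add_mul]
      map_smul' := by intro c x; ext; simp [mul_assoc] }
  have hφ : Function.Injective φ := by
    rw [injective_iff_map_eq_zero]
    intro x hx
    have : x.1 * f s = 0 := congrArg Subtype.val hx
    ext
    exact ((h.unit s hs).mul_left_eq_zero).1 this
  obtain ⟨y, hy⟩ := IsArtinian.surjective_of_injective_endomorphism φ hφ ⟨z, hz⟩
  have hy' : y.1 * f s = z := congrArg Subtype.val hy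
  rw [← hy', mul_assoc, hr]
  exact h1 r _ y.2

theorem prime_of_frac [IsArtinianRing Q] [IsSimpleRing Q] (h : Frac f S) :
    IsPrimeIdealSet {r : R | f r = 0} := by
  refine ⟨⟨map_zero f, ?_, ?_⟩, ?_, ?_⟩
  · intro x hx y hy
    change f (x + y) = 0
    rw [map_add, show f x = 0 from hx, show f y = 0 from hy, add_zero]
  · intro r x hx
    constructor
    · change f (r * x) = 0
      rw [map_mul, show f x = 0 from hx, mul_zero]
    · change f (x * r) = 0
      rw [map_mul, show f x = 0 from hx, zero_mul]
  · intro hu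
    have : (1 : R) ∈ {r : R | f r = 0} := by rw [hu]; trivial
    have h1 : f 1 = 0 := this
    rw [map_one] at h1
    exact one_ne_zero h1
  · intro x y hxy
    by_contra hcon
    push Not at hcon
    obtain ⟨hx, hy⟩ := hcon
    let J : Submodule R R :=
      { carrier := {t | ∀ r, f (x * r * t) = 0}
        add_mem' := by
          intro a b ha hb r
          rw [mul_add, map_add, ha r, hb r, add_zero]
        zero_mem' := by intro r; simp
        smul_mem' := by
          intro c t ht r
          rw [smul_eq_mul, ← mul_assoc, mul_assoc x]
          exact ht _ }
    have hJ : ∀ t ∈ J, ∀ r, t * r ∈ J := by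
      intro t ht r r'
      rw [← mul_assoc, map_mul, ht r', zero_mul]
    let T : TwoSidedIdeal Q := TwoSidedIdeal.mk' (Submodule.span Q (f '' (J : Set R)) : Set Q)
      (Submodule.zero_mem _) (fun ha hb => Submodule.add_mem _ ha hb)
      (fun ha => Submodule.neg_mem _ ha) (fun {a b} hb => Submodule.smul_mem _ a hb)
      (fun {a b} ha => h.span_right J hJ a b ha)
    have hyT : f y ∈ T := by
      rw [TwoSidedIdeal.mem_mk']
      exact Submodule.subset_span ⟨y, hxy, rfl⟩
    have h1T : (1 : Q) ∈ T := by
      have : T = ⊤ := by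
        rcases eq_bot_or_eq_top T with hT | hT
        · rw [hT] at hyT
          exact absurd ((TwoSidedIdeal.mem_bot _).1 hyT) hy
        · exact hT
      rw [this]; trivial
    rw [TwoSidedIdeal.mem_mk'] at h1T
    obtain ⟨s, hs, k, hk, e⟩ := h.span_clear J 1 h1T
    have h2 := hk 1
    rw [mul_one, map_mul, ← e, mul_one] at h2
    exact hx (((h.unit s hs).mul_left_eq_zero).1 h2)

theorem Frac.common_finset (h : Frac f S) {κ : Type*} (T : Finset κ) (v : κ → Q) :
    ∃ s ∈ S, ∀ k ∈ T, ∃ r, f s * v k = f r := by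
  classical
  induction T using Finset.induction_on with
  | empty =>
    obtain ⟨s, hs, -⟩ := h.frac 0
    exact ⟨s, hs, by simp⟩
  | insert k T _ ih =>
    obtain ⟨s, hs, hT⟩ := ih
    obtain ⟨t, ht, r, hr⟩ := h.frac (f s * v k)
    refine ⟨t * s, h.mul _ ht _ hs, ?_⟩
    intro j hj
    rcases Finset.mem_insert.1 hj with rfl | hj
    · exact ⟨r, by rw [map_mul, mul_assoc, hr]⟩
    · obtain ⟨r', hr'⟩ := hT j hj
      exact ⟨t * r', by rw [map_mul, mul_assoc, hr', map_mul]⟩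

theorem acc_of_frac [IsNoetherianRing Q] (hinj : Function.Injective f) :
    AccOnSets {B : Set R | ∃ X : Set R, B = lAnn X} := by
  intro F hF hmono
  let E : ℕ → Submodule Q Q := fun n =>
    { carrier := lAnn (f '' rAnn (F n))
      add_mem' := by
        intro a b ha hb x hx
        rw [add_mul, ha x hx, hb x hx, add_zero]
      zero_mem' := by intro x hx; simp
      smul_mem' := by
        intro c a ha x hx
        rw [smul_eq_mul, mul_assoc, ha x hx, mul_zero] }
  have hE : Monotone E := by
    apply monotone_nat_of_le_succ
    rintro n b hb _ ⟨x, hx, rfl⟩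
    exact hb _ ⟨x, fun y hy => hx y (hmono n hy), rfl⟩
  obtain ⟨N, hN⟩ := monotone_stabilizes_iff_noetherian.2
    (inferInstance : IsNoetherian Q Q) ⟨E, hE⟩
  refine ⟨N, fun k hk => ?_⟩
  apply Set.Subset.antisymm _ (monotone_nat_of_le_succ hmono hk)
  intro x hx
  obtain ⟨X, hXe⟩ := hF N
  rw [hXe]
  intro z hz
  have hz' : z ∈ rAnn (F N) := by
    intro y hy
    rw [hXe] at hy
    exact hy z hz
  have h2 : f x ∈ E k := by
    rintro _ ⟨t, ht, rfl⟩
    rw [← map_mul, ht x hx, map_zero]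
  have h3 : E N = E k := hN k hk
  rw [← h3] at h2
  apply hinj
  rw [map_mul, map_zero]
  exact h2 _ ⟨z, hz', rfl⟩

theorem finUdim_of_frac [IsSemisimpleRing Q] [Nontrivial Q] (h : Frac f S)
    (hinj : Function.Injective f) : FinUdim R := by
  obtain ⟨s, hind, hsup, hsimple⟩ := IsSemisimpleModule.exists_sSupIndep_sSup_simples_eq_top Q Q
  have hfin : s.Finite := WellFoundedGT.finite_of_sSupIndep hind
  obtain ⟨m, V, hVinj, hVr⟩ := hfin.fin_param
  have hVs : ∀ i, IsSimpleModule Q (V i) := fun i => hsimple _ (hVr ▸ Set.mem_range_self i)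
  have hVind : iSupIndep V := by
    have h2 := (sSupIndep_iff _).1 hind
    have h3 := h2.comp (f := fun i => (⟨V i, hVr ▸ Set.mem_range_self i⟩ : { x // x ∈ s }))
      (fun i j hij => hVinj (congrArg Subtype.val hij))
    exact h3
  have hVsup : ⨆ i, V i = ⊤ := by rw [← hsup, ← hVr]; rfl
  obtain ⟨n, rfl⟩ : ∃ n, m = n + 1 := by
    cases m with
    | zero =>
      exfalso
      rw [iSup_of_empty] at hVsup
      exact bot_ne_top hVsup
    | succ n => exact ⟨n, rfl⟩
  have hf0 : ∀ x, f x = 0 → x = 0 := fun x hx => hinj (by rw [hx, map_zero])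
  refine ⟨n, fun i => contr f (V i), ?_, ?_, ?_⟩
  · intro i
    have hatom : IsAtom (V i) := isSimpleModule_iff_isAtom.1 (hVs i)
    refine ⟨?_, ?_⟩
    · obtain ⟨v, hv, hv0⟩ := (Submodule.ne_bot_iff _).1 hatom.1
      obtain ⟨t, ht, r, hr⟩ := h.frac v
      rw [Submodule.ne_bot_iff]
      refine ⟨r, ?_, ?_⟩
      · rw [mem_contr, ← hr]; exact (V i).smul_mem _ hv
      · rintro rfl
        rw [map_zero] at hr
        exact hv0 (h.cancel ht hr)
    · intro W W' hW hW' hW0 hW0'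
      obtain ⟨w, hw, hw0⟩ := (Submodule.ne_bot_iff _).1 hW0
      obtain ⟨w', hw', hw0'⟩ := (Submodule.ne_bot_iff _).1 hW0'
      have hspan : Submodule.span Q {f w} = V i := by
        rcases hatom.le_iff.1 ((Submodule.span_singleton_le_iff_mem (f w) (V i)).2 (hW hw)) with e | e
        · rw [Submodule.span_singleton_eq_bot] at e
          exact absurd (hf0 _ e) hw0
        · exact e
      have hmem : f w' ∈ Submodule.span Q {f w} := by rw [hspan]; exact hW' hw'
      obtain ⟨q, hq⟩ := Submodule.mem_span_singleton.1 hmem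
      obtain ⟨t, ht, r, hr⟩ := h.frac q
      have e : r * w = t * w' := by
        apply hinj
        rw [map_mul, map_mul, ← hr, ← hq, smul_eq_mul, mul_assoc]
      rw [Submodule.ne_bot_iff]
      refine ⟨r * w, ⟨W.smul_mem r hw, ?_⟩, ?_⟩
      · rw [e]; exact W'.smul_mem t hw'
      · rw [e]
        intro h0
        have h1 : f t * f w' = 0 := by rw [← map_mul, h0, map_zero]
        exact hw0' (hf0 _ (h.cancel ht h1))
  · intro i
    rw [eq_bot_iff]
    rintro x ⟨hx1, hx2⟩
    have hle : (⨆ j, ⨆ (_ : j ≠ i), contr f (V j)) ≤ contr f (⨆ j, ⨆ (_ : j ≠ i), V j) := by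
      refine iSup_le fun j => iSup_le fun hj => ?_
      intro y hy
      rw [mem_contr]
      exact Submodule.mem_iSup_of_mem j (Submodule.mem_iSup_of_mem hj hy)
    have := Submodule.disjoint_def.1 (hVind i) (f x) hx1 (hle hx2)
    exact (Submodule.mem_bot R).2 (hf0 x this)
  · intro J hJ
    obtain ⟨y, hy, hy0⟩ := (Submodule.ne_bot_iff _).1 hJ
    have hyV : f y ∈ ⨆ i, V i := by rw [hVsup]; trivial
    obtain ⟨φ, hφ, hsum⟩ := (Submodule.mem_iSup_iff_exists_finsupp V _).1 hyV
    have hsum' : ∑ k, φ k = f y := by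
      rw [← hsum, Finsupp.sum_fintype]
      intro i; rfl
    obtain ⟨t, ht, hr⟩ := h.common_finset Finset.univ (fun k => φ k)
    have hr' : ∀ k, ∃ r, f t * φ k = f r := fun k => hr k (Finset.mem_univ k)
    choose r hr' using hr'
    have e : t * y = ∑ k, r k := by
      apply hinj
      rw [map_mul, ← hsum', Finset.mul_sum, map_sum]
      exact Finset.sum_congr rfl fun k _ => hr' k
    rw [Submodule.ne_bot_iff]
    refine ⟨t * y, ⟨?_, J.smul_mem t hy⟩, ?_⟩
    · rw [e]
      apply Submodule.sum_mem
      intro k _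
      refine Submodule.mem_iSup_of_mem k ?_
      rw [mem_contr, ← hr']
      exact (V k).smul_mem _ (hφ k)
    · intro h0
      have h1 : f t * f y = 0 := by rw [← map_mul, h0, map_zero]
      exact hy0 (hf0 _ (h.cancel ht h1))

theorem Frac.range (h : Frac f S) : Frac f.range.subtype (f.rangeRestrict '' S) := by
  refine ⟨?_, ?_, ?_⟩
  · rintro _ ⟨a, ha, rfl⟩ _ ⟨b, hb, rfl⟩
    exact ⟨a * b, h.mul a ha b hb, by rw [map_mul]⟩
  · rintro _ ⟨a, ha, rfl⟩
    exact h.unit a ha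
  · intro q
    obtain ⟨s, hs, r, hr⟩ := h.frac q
    exact ⟨_, ⟨s, hs, rfl⟩, f.rangeRestrict r, hr⟩

theorem leftGoldie_range [IsSemisimpleRing Q] [Nontrivial Q] (h : Frac f S) :
    LeftGoldie f.range :=
  ⟨acc_of_frac (f := f.range.subtype) Subtype.val_injective,
    finUdim_of_frac h.range Subtype.val_injective⟩

theorem isQuotBy_range (f : R →+* Q) : IsQuotBy {r : R | f r = 0} f.rangeRestrict := by
  refine ⟨f.rangeRestrict_surjective, fun r => ?_⟩
  constructor
  · intro h
    exact congrArg Subtype.val h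
  · intro h
    exact Subtype.ext h

end Converse

theorem dir1 {R : Type u} [Ring R]
    (Q : Type u) [Ring Q] (f : R →+* Q) (hf : IsLeftLoc (lReg R) f) [IsSemisimpleRing Q] :
    IsSemiprimeIdealSet (ass (lReg R)) ∧
     (minPrimesOver (ass (lReg R))).Finite ∧
     (∀ p ∈ minPrimesOver (ass (lReg R)),
       ∃ (Rp : Type u) (_ : Ring Rp) (πp : R →+* Rp),
         IsQuotBy p πp ∧ LeftGoldie Rp) ∧
     (∃ (Rb : Type u) (_ : Ring Rb) (π : R →+* Rb),
       IsQuotBy (ass (lReg R)) π ∧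
       π '' lReg R ⊆ reg Rb ∧ DenseIn (π '' lReg R) (reg Rb)) := by
  obtain ⟨hunit, hfrac, hker⟩ := hf
  have hmul : ∀ a ∈ lReg R, ∀ b ∈ lReg R, a * b ∈ lReg R :=
    fun a ha b hb x hx => ha x (hb _ (by rw [mul_assoc]; exact hx))
  have hF : Frac f (lReg R) := ⟨hmul, hunit, hfrac⟩
  have hass : ass (lReg R) = {r : R | f r = 0} := by
    ext r; exact (hker r).symm
  rw [hass]
  obtain ⟨n, D, d, hD, hd, ⟨e⟩⟩ := IsSemisimpleRing.exists_ringEquiv_pi_matrix_divisionRing Q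
  let fi : ∀ i, R →+* Matrix (Fin (d i)) (Fin (d i)) (D i) := fun i =>
    ((Pi.evalRingHom _ i).comp e.toRingHom).comp f
  have hfi : ∀ i r, fi i r = e (f r) i := fun _ _ => rfl
  have hFi : ∀ i, Frac (fi i) (lReg R) := by
    intro i
    refine ⟨hmul, fun s hs => (hunit s hs).map ((Pi.evalRingHom _ i).comp e.toRingHom), ?_⟩
    intro q
    obtain ⟨s, hs, r, hr⟩ := hfrac (e.symm (Pi.single i q))
    refine ⟨s, hs, r, ?_⟩
    have := congrFun (congrArg e hr) i
    rw [map_mul, e.apply_symm_apply, Pi.mul_apply, Pi.single_eq_same] at this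
    exact this
  have hprime : ∀ i, IsPrimeIdealSet {r : R | fi i r = 0} := fun i => prime_of_frac (hFi i)
  have hinter : ∀ r, f r = 0 ↔ ∀ i, fi i r = 0 := by
    intro r
    constructor
    · intro h i
      rw [hfi, h, map_zero]; rfl
    · intro h
      apply e.injective
      rw [map_zero]
      funext i
      exact h i
  have hmin : ∀ p ∈ minPrimesOver {r : R | f r = 0}, ∃ i, {r : R | fi i r = 0} = p := by
    rintro p ⟨hp, hap, hpm⟩
    suffices hex : ∃ i, {r : R | fi i r = 0} ⊆ p by
      obtain ⟨i, hi⟩ := hex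
      exact ⟨i, hpm _ (hprime i) (fun r hr => (hinter r).1 hr i) hi⟩
    by_contra hcon
    push Not at hcon
    have hcon' : ∀ i, ∃ x, fi i x = 0 ∧ x ∉ p := fun i => by
      obtain ⟨x, hx, hxp⟩ := Set.not_subset.1 (hcon i)
      exact ⟨x, hx, hxp⟩
    choose x hx hxp using hcon'
    have key : ∀ T : Finset (Fin n), ∃ z, z ∉ p ∧ ∀ i ∈ T, fi i z = 0 := by
      intro T
      induction T using Finset.induction_on with
      | empty =>
        refine ⟨1, fun h1 => hp.2.1 ?_, by simp⟩
        rw [Set.eq_univ_iff_forall]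
        intro y
        have := (hp.1.2.2 y 1 h1).1
        rwa [mul_one] at this
      | insert i T _ ih =>
        obtain ⟨z, hz, hzT⟩ := ih
        have : ∃ r, z * r * x i ∉ p := by
          by_contra hc
          push Not at hc
          rcases hp.2.2 z (x i) hc with h | h
          · exact hz h
          · exact hxp i h
        obtain ⟨r, hr⟩ := this
        refine ⟨_, hr, ?_⟩
        intro j hj
        rcases Finset.mem_insert.1 hj with rfl | hj
        · rw [map_mul, hx, mul_zero]
        · rw [map_mul, map_mul, hzT j hj, zero_mul, zero_mul]
    obtain ⟨z, hz, hzT⟩ := key Finset.univ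
    exact hz (hap ((hinter z).2 fun i => hzT i (Finset.mem_univ i)))
  refine ⟨⟨⟨map_zero f, ?_, ?_⟩, ?_⟩, ?_, ?_, f.range, inferInstance, f.rangeRestrict,
    isQuotBy_range f, ?_, ?_⟩
  · intro x hx y hy
    change f (x + y) = 0
    rw [map_add, show f x = 0 from hx, show f y = 0 from hy, add_zero]
  · intro r x hx
    constructor
    · change f (r * x) = 0
      rw [map_mul, show f x = 0 from hx, mul_zero]
    · change f (x * r) = 0
      rw [map_mul, show f x = 0 from hx, zero_mul]
  · intro x hx
    change f x = 0
    rw [hinter]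
    intro i
    rcases (hprime i).2.2 x x (fun r => (hinter _).1 (hx r) i) with h | h <;> exact h
  · apply (Set.finite_range fun i => {r : R | fi i r = 0}).subset
    intro p hp
    exact hmin p hp
  · intro p hp
    obtain ⟨i, rfl⟩ := hmin p hp
    exact ⟨(fi i).range, inferInstance, (fi i).rangeRestrict, isQuotBy_range _,
      leftGoldie_range (hFi i)⟩
  · rintro _ ⟨s, hs, rfl⟩
    refine ⟨fun x hx => ?_, fun x hx => ?_⟩
    · have : x.1 * f s = 0 := congrArg Subtype.val hx
      exact Subtype.ext (((hunit s hs).mul_left_eq_zero).1 this)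
    · have : f s * x.1 = 0 := congrArg Subtype.val hx
      exact Subtype.ext (((hunit s hs).mul_right_eq_zero).1 this)
  · rintro ⟨_, t, rfl⟩ ht
    have hinj : Function.Injective (LinearMap.toSpanSingleton Q Q (f t)) := by
      rw [injective_iff_map_eq_zero]
      intro q hq
      rw [LinearMap.toSpanSingleton_apply, smul_eq_mul] at hq
      obtain ⟨s, hs, r, hr⟩ := hfrac q
      have h1 : f r * f t = 0 := by rw [← hr, mul_assoc, hq, mul_zero]
      have h2 := ht.1 ⟨f r, r, rfl⟩ (Subtype.ext h1)
      have h3 : f r = 0 := congrArg Subtype.val h2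
      rw [h3] at hr
      exact ((hunit s hs).mul_right_eq_zero).1 hr
    obtain ⟨v, hv⟩ := IsArtinian.surjective_of_injective_endomorphism _ hinj 1
    rw [LinearMap.toSpanSingleton_apply, smul_eq_mul] at hv
    obtain ⟨s, hs, r, hr⟩ := hfrac v
    refine ⟨⟨f r, r, rfl⟩, s, hs, Subtype.ext ?_⟩
    change f s = f r * f t
    rw [← hr, mul_assoc, hv, mul_one]


/-- Theorem 7Mar15: `'Q_{l,cl}(R)` is semisimple Artinian iff `a = ass_R('C_R)` is a
semiprime ideal with finitely many minimal primes, `R/p` is a left Goldie ring for every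
minimal prime `p` over `a`, and `'C̄` is a dense subset of `C_{R̄}` where `R̄ = R/a`. -/
theorem classicalLeftRegularLeftQuotient_semisimple_iff_goldie
    {R : Type u} [Ring R] [Nontrivial R] :
    (IsLeftDenom (lReg R) ∧
      ∃ (Q : Type u) (_ : Ring Q) (f : R →+* Q),
        IsLeftLoc (lReg R) f ∧ IsSemisimpleRing Q) ↔
    -- (a)
    (IsSemiprimeIdealSet (ass (lReg R)) ∧
     (minPrimesOver (ass (lReg R))).Finite ∧
     -- (b)
     (∀ p ∈ minPrimesOver (ass (lReg R)),
       ∃ (Rp : Type u) (_ : Ring Rp) (πp : R →+* Rp),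
         IsQuotBy p πp ∧ LeftGoldie Rp) ∧
     -- (c)
     (∃ (Rb : Type u) (_ : Ring Rb) (π : R →+* Rb),
       IsQuotBy (ass (lReg R)) π ∧
       π '' lReg R ⊆ reg Rb ∧ DenseIn (π '' lReg R) (reg Rb))) := by
  constructor
  · rintro ⟨-, Q, hQ, f, hf, hss⟩
    exact dir1 Q f hf
  · rintro ⟨ha, hfin, hb, Rb, hRb, π, hπ, hreg, hdense⟩
    exact dir2 ha hfin hb Rb π hπ hreg hdense

end Bavula
end
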